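/- For every s < 0 there exists a constant C_s > 0 such that for all n ∈ ℕ, if U_n is Haar distributed on O(n) (or on Sp(2n)), then ∑_{k=1}^∞ (1 + k²)^s · E[(Tr(U_n^k))²] / k² ≤ C_s; in particular the supremum over n of the expected squared H^s-norm of the field with Fourier coefficients −Tr(U_n^{|j|})/(2|j|) (j ≠ 0) is finite. -/

import Mathlib

open MeasureTheory ProbabilityTheory Matrix Filter Topology

noncomputable section

instance matMS (n m R : Type*) [MeasurableSpace R] : MeasurableSpace (Matrix n m R) :=
  MeasurableSpace.pi

/-- `μ` is the Haar probability measure on the orthogonal group `O(n)`. -/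
def IsHaarON (n : ℕ) (μ : Measure (Matrix (Fin n) (Fin n) ℝ)) : Prop :=
  IsProbabilityMeasure μ ∧
  μ ((Matrix.orthogonalGroup (Fin n) ℝ : Set (Matrix (Fin n) (Fin n) ℝ))ᶜ) = 0 ∧
  ∀ V : Matrix (Fin n) (Fin n) ℝ, V ∈ Matrix.orthogonalGroup (Fin n) ℝ →
    Measure.map (fun U => V * U) μ = μ

/-- The standard symplectic form matrix `J = [[0, Iₙ], [−Iₙ, 0]]`. -/
def sympJ (n : ℕ) : Matrix (Fin n ⊕ Fin n) (Fin n ⊕ Fin n) ℂ :=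
  Matrix.fromBlocks 0 1 (-1) 0

/-- Membership in the compact symplectic group `Sp(2n)`. -/
def InCompactSp (n : ℕ) (U : Matrix (Fin n ⊕ Fin n) (Fin n ⊕ Fin n) ℂ) : Prop :=
  U ∈ Matrix.unitaryGroup (Fin n ⊕ Fin n) ℂ ∧
    U * sympJ n * U.transpose = sympJ n ∧ U.transpose * sympJ n * U = sympJ n

/-- `μ` is the Haar probability measure on `Sp(2n)`. -/
def IsHaarSp (n : ℕ) (μ : Measure (Matrix (Fin n ⊕ Fin n) (Fin n ⊕ Fin n) ℂ)) : Prop :=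
  IsProbabilityMeasure μ ∧
  μ {U | ¬ InCompactSp n U} = 0 ∧
  ∀ V, InCompactSp n V → Measure.map (fun U => V * U) μ = μ

/-- The expected squared `H^s`-norm of the field with Fourier coefficients
`−Tr(U^{|j|})/(2|j|)` for `j ≠ 0` (and zero coefficient at `j = 0`), for a real-trace
function `tr : ℕ → ℝ`: `∑_{j ∈ ℤ, j ≠ 0} (1+j²)^s (tr |j| / (2|j|))²`. -/
def hsNormSq (s : ℝ) (tr : ℕ → ℝ) : ℝ :=
  ∑' j : ℤ, if j = 0 then 0 else
    ((1 + (j : ℝ) ^ 2) ^ s) * (-(tr j.natAbs) / (2 * (j.natAbs : ℝ))) ^ 2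

/-- An additive map satisfying the Leibniz rule. -/
def IsDer {B : Type*} [CommRing B] (D : B →+ B) : Prop :=
  ∀ a b, D (a * b) = a * D b + b * D a

namespace IsDer

variable {B : Type*} [CommRing B] {D : B →+ B}

lemma map_one (hD : IsDer D) : D 1 = 0 := by
  have h := hD 1 1
  simpa using h

lemma map_pow (hD : IsDer D) (a : B) (n : ℕ) : D (a ^ (n + 1)) = (n + 1) * a ^ n * D a := by
  induction n with
  | zero => simp
  | succ n ih => rw [pow_succ, hD, ih]; push_cast; ring

lemma map_pow_eq_zero (hD : IsDer D) {a : B} (ha : D a = 0) (n : ℕ) : D (a ^ n) = 0 := by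
  cases n with
  | zero => simpa using hD.map_one
  | succ n => rw [hD.map_pow, ha, mul_zero]

lemma map_natCast (hD : IsDer D) (n : ℕ) : D n = 0 := by
  induction n with
  | zero => simp
  | succ n ih => push_cast; rw [map_add, ih, hD.map_one, add_zero]

lemma natCast_mul (hD : IsDer D) (n : ℕ) (a : B) : D (n * a) = n * D a := by
  rw [hD, hD.map_natCast]; ring

end IsDer

namespace PowerSeries

variable {B : Type*} [CommRing B]

/-- The coefficientwise extension of an additive map to power series. -/
def coeffMap (D : B →+ B) : PowerSeries B →+ PowerSeries B where
  toFun f := PowerSeries.mk fun n => D (coeff n f)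
  map_zero' := by ext n; simp
  map_add' f g := by ext n; simp

@[simp] lemma coeff_coeffMap (D : B →+ B) (f : PowerSeries B) (n : ℕ) :
    coeff n (coeffMap D f) = D (coeff n f) := by
  simp [coeffMap]

@[simp] lemma constantCoeff_coeffMap (D : B →+ B) (f : PowerSeries B) :
    constantCoeff (coeffMap D f) = D (constantCoeff f) := by
  rw [← coeff_zero_eq_constantCoeff_apply, coeff_coeffMap, coeff_zero_eq_constantCoeff_apply]

lemma isDer_coeffMap {D : B →+ B} (hD : IsDer D) : IsDer (coeffMap D) := by
  intro f g
  ext n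
  simp only [coeff_coeffMap, coeff_mul, map_sum, map_add, hD _ _, Finset.sum_add_distrib]
  congr 1
  rw [← Finset.Nat.sum_antidiagonal_swap]
  rfl

/-- The Euler operator `X d/dX`. -/
def euler (B : Type*) [CommRing B] : PowerSeries B →+ PowerSeries B where
  toFun f := PowerSeries.mk fun n => (n : B) * coeff n f
  map_zero' := by ext n; simp
  map_add' f g := by ext n; simp [mul_add]

@[simp] lemma coeff_euler (f : PowerSeries B) (n : ℕ) :
    coeff n (euler B f) = n * coeff n f := by
  simp [euler]

lemma isDer_euler (B : Type*) [CommRing B] : IsDer (euler B) := by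
  intro f g
  ext n
  simp only [coeff_euler, coeff_mul, map_add]
  conv_rhs => rw [add_comm, ← Finset.Nat.sum_antidiagonal_swap]
  rw [← Finset.sum_add_distrib, Finset.mul_sum]
  refine Finset.sum_congr rfl fun x hx => ?_
  rw [← (Finset.HasAntidiagonal.mem_antidiagonal.mp hx : x.1 + x.2 = n)]
  simp only [Prod.fst_swap, Prod.snd_swap]
  push_cast
  ring

@[simp] lemma coeffMap_C (D : B →+ B) (a : B) : coeffMap D (C a) = C (D a) := by
  ext n
  simp only [coeff_coeffMap, coeff_C]
  split_ifs <;> simp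

@[simp] lemma euler_C (a : B) : euler B (C a) = 0 := by
  ext n
  simp only [coeff_euler, coeff_C]
  split_ifs with h <;> simp [h]

lemma coeffMap_X {D : B →+ B} (hD : IsDer D) : coeffMap D X = 0 := by
  ext n
  simp only [coeff_coeffMap, coeff_X]
  split_ifs <;> simp [hD.map_one]

@[simp] lemma euler_X : euler B X = X := by
  ext n
  simp only [coeff_euler, coeff_X]
  split_ifs with h <;> simp [h]

lemma coeffMap_map_C (D : B →+ B) (f : PowerSeries B) :
    coeffMap (coeffMap D) (map (C (R := B)) f) = map (C (R := B)) (coeffMap D f) := by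
  ext n : 1
  simp

lemma coeffMap_euler_map_C (f : PowerSeries B) :
    coeffMap (euler B) (map (C (R := B)) f) = 0 := by
  ext n : 1
  simp

lemma euler_map_C (f : PowerSeries B) :
    euler (PowerSeries B) (map (C (R := B)) f) = map (C (R := B)) (euler B f) := by
  ext n : 1
  simp

lemma eq_zero_of_euler_eq_mul [IsDomain B] [CharZero B] {Q y : PowerSeries B}
    (h : euler B y = Q * y) (hQ : coeff 0 Q = 0) (hy : coeff 0 y = 0) : y = 0 := by
  ext n
  induction n using Nat.strong_induction_on with
  | _ n ih =>
    rcases Nat.eq_zero_or_pos n with rfl | hn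
    · simpa using hy
    · have h1 := congrArg (coeff n) h
      rw [coeff_euler, coeff_mul, Finset.sum_eq_zero] at h1
      · simpa [hn.ne'] using h1
      · rintro ⟨i, j⟩ hij
        rw [Finset.HasAntidiagonal.mem_antidiagonal] at hij
        rcases Nat.eq_zero_or_pos i with rfl | hi
        · simp [hQ]
        · rw [ih j (by simp at hij; omega)]; simp

lemma eq_of_euler_eq_mul [IsDomain B] [CharZero B] {Q y y' : PowerSeries B}
    (h : euler B y = Q * y) (h' : euler B y' = Q * y') (hQ : coeff 0 Q = 0)
    (hy : coeff 0 y = coeff 0 y') : y = y' := by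
  refine sub_eq_zero.mp (eq_zero_of_euler_eq_mul (Q := Q) ?_ hQ ?_)
  · rw [map_sub, h, h', mul_sub]
  · rw [map_sub, hy, sub_self]

end PowerSeries

section

open PowerSeries

section Newton

variable {B : Type*} [CommRing B] [Algebra ℚ B]

/-- The sequence `q` with `q 0 = 1` and `k q k = c ∑_{j=1}^k p j q (k - j)`. -/
def newton (c : ℤ) (p : ℕ → B) : ℕ → B
  | 0 => 1
  | k + 1 => ((k : ℚ) + 1)⁻¹ • ((c : B) * ∑ i : Fin (k + 1), p (k + 1 - i) * newton c p i)

/-- The generating series of the sequence `newton c p`. -/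
def newtonSeries (c : ℤ) (p : ℕ → B) : PowerSeries B := PowerSeries.mk (newton c p)

/-- The generating series `∑_{k ≥ 1} p k X ^ k`. -/
def powerSumSeries (p : ℕ → B) : PowerSeries B := PowerSeries.mk fun k => if k = 0 then 0 else p k

@[simp] lemma coeff_newtonSeries (c : ℤ) (p : ℕ → B) (k : ℕ) :
    coeff k (newtonSeries c p) = newton c p k := by
  simp [newtonSeries]

@[simp] lemma newton_zero (c : ℤ) (p : ℕ → B) : newton c p 0 = 1 := by
  rw [newton]

omit [Algebra ℚ B] in
@[simp] lemma coeff_powerSumSeries (p : ℕ → B) (k : ℕ) :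
    coeff k (powerSumSeries p) = if k = 0 then 0 else p k := by
  simp [powerSumSeries]

@[simp] lemma constantCoeff_newtonSeries (c : ℤ) (p : ℕ → B) :
    constantCoeff (newtonSeries c p) = 1 := by
  rw [← coeff_zero_eq_constantCoeff_apply, coeff_newtonSeries, newton_zero]

omit [Algebra ℚ B] in
@[simp] lemma constantCoeff_powerSumSeries (p : ℕ → B) :
    constantCoeff (powerSumSeries p) = 0 := by
  rw [← coeff_zero_eq_constantCoeff_apply, coeff_powerSumSeries, if_pos rfl]

lemma succ_mul_newton (c : ℤ) (p : ℕ → B) (k : ℕ) :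
    ((k : B) + 1) * newton c p (k + 1)
      = c * ∑ i ∈ Finset.range (k + 1), p (k + 1 - i) * newton c p i := by
  rw [newton, Finset.sum_range (fun i => p (k + 1 - i) * newton c p i), mul_smul_comm,
    ← smul_mul_assoc]
  have h : ((k : ℚ) + 1)⁻¹ • ((k : B) + 1) = 1 := by
    have h1 : ((k : B) + 1) = algebraMap ℚ B ((k : ℚ) + 1) := by simp
    have h2 : ((k : ℚ) + 1) ≠ 0 := by positivity
    rw [h1, Algebra.smul_def, ← map_mul, inv_mul_cancel₀ h2, map_one]
  rw [h, one_mul]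

lemma euler_newtonSeries (c : ℤ) (p : ℕ → B) :
    euler B (newtonSeries c p) = (c * powerSumSeries p) * newtonSeries c p := by
  ext k
  have hc : (c : PowerSeries B) = C (c : B) := by simp
  rw [mul_assoc, hc, coeff_C_mul, mul_comm (powerSumSeries p), coeff_mul,
    Finset.Nat.sum_antidiagonal_eq_sum_range_succ_mk]
  cases k with
  | zero => simp
  | succ k =>
    rw [Finset.sum_range_succ]
    simp only [coeff_euler, coeff_newtonSeries, coeff_powerSumSeries, Nat.cast_succ, tsub_self,
      if_true, mul_zero, add_zero]
    rw [succ_mul_newton]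
    congr 1
    refine Finset.sum_congr rfl fun i hi => ?_
    rw [if_neg (by simp at hi; omega), mul_comm]

variable [IsDomain B] [CharZero B]

lemma newtonSeries_mul_newtonSeries (p : ℕ → B) :
    newtonSeries 1 p * newtonSeries (-1) p = 1 := by
  refine eq_of_euler_eq_mul (Q := 0) ?_ ?_ (by simp) (by simp)
  · rw [isDer_euler, euler_newtonSeries, euler_newtonSeries]
    push_cast
    ring
  · rw [(isDer_euler B).map_one, zero_mul]

lemma coeffMap_newtonSeries (c : ℤ) (hc : c * c = 1) (p : ℕ → B) {δ : B →+ B}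
    (hδ : IsDer δ) {j : ℕ} (hj : 1 ≤ j)
    (hp : ∀ i, δ (p i) = if i = j then (j : B) else 0) :
    coeffMap δ (newtonSeries c p) = (c : PowerSeries B) * X ^ j * newtonSeries c p := by
  have hR : coeffMap δ (powerSumSeries p) = (j : PowerSeries B) * X ^ j := by
    ext k
    have hj' : (j : PowerSeries B) = C (j : B) := by simp
    rw [coeff_coeffMap, coeff_powerSumSeries, hj', coeff_C_mul, coeff_X_pow]
    split_ifs with h1 h2 h2
    · omega
    · simp
    · rw [hp, if_pos h2, mul_one]
    · rw [hp, if_neg h2, mul_zero]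
  have hcomm : ∀ f, euler B (coeffMap δ f) = coeffMap δ (euler B f) := by
    intro f
    ext k
    simp [hδ.natCast_mul]
  have hX : euler B (X ^ j) = (j : PowerSeries B) * X ^ j := by
    obtain ⟨i, rfl⟩ : ∃ i, j = i + 1 := ⟨j - 1, by omega⟩
    rw [(isDer_euler B).map_pow, euler_X, pow_succ]
    push_cast
    ring
  have hc' : ∀ {D : PowerSeries B →+ PowerSeries B}, IsDer D → ∀ f, D (c * f) = c * D f := by
    intro D hD f
    rcases Int.mul_eq_one_iff_eq_one_or_neg_one.mp hc with ⟨h, -⟩ | ⟨h, -⟩ <;> simp [h]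
  have hcc : (c : PowerSeries B) * c = 1 := by exact_mod_cast congrArg (Int.cast : ℤ → PowerSeries B) hc
  refine sub_eq_zero.mp (eq_zero_of_euler_eq_mul (Q := (c : PowerSeries B) * powerSumSeries p) ?_ ?_ ?_)
  · rw [map_sub, hcomm, euler_newtonSeries, (isDer_coeffMap hδ), hc' (isDer_coeffMap hδ), hR, isDer_euler, hc' (isDer_euler B), euler_newtonSeries, hX]
    ring
  · simp
  · simp [hδ.map_one, show j ≠ 0 by omega]

end Newton

section Hook

/-- The first variable of the ring of double power series. -/
def serX (B : Type*) [CommRing B] : PowerSeries (PowerSeries B) := C X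

/-- The second variable of the ring of double power series. -/
def serZ (B : Type*) [CommRing B] : PowerSeries (PowerSeries B) := X

/-- The series `(1 - x z)⁻¹`. -/
def serU (B : Type*) [CommRing B] : PowerSeries (PowerSeries B) := PowerSeries.mk fun k => X ^ k

/-- The factor `1 - x ^ 2` (orthogonal case) or `1 - z ^ 2` (symplectic case). -/
def serW (B : Type*) [CommRing B] (ε : ℤ) : PowerSeries (PowerSeries B) :=
  if ε = 1 then 1 - serX B ^ 2 else 1 - serZ B ^ 2

variable {B : Type*} [CommRing B]

lemma serU_mul : serU B * (1 - serX B * serZ B) = 1 := by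
  have h : serU B = 1 + serX B * serZ B * serU B := by
    ext n : 1
    rw [map_add, mul_assoc, serX, serZ, coeff_C_mul]
    cases n with
    | zero => simp [serU]
    | succ n => simp [serU, coeff_succ_X_mul, pow_succ', coeff_one]
  linear_combination h

/-- The coefficient of `x ^ a z ^ b`. -/
def coeff₂ (a b : ℕ) (f : PowerSeries (PowerSeries B)) : B := coeff a (coeff b f)

lemma coeff₂_add (a b : ℕ) (f g : PowerSeries (PowerSeries B)) :
    coeff₂ a b (f + g) = coeff₂ a b f + coeff₂ a b g := by simp [coeff₂]

lemma coeff₂_sub (a b : ℕ) (f g : PowerSeries (PowerSeries B)) :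
    coeff₂ a b (f - g) = coeff₂ a b f - coeff₂ a b g := by simp [coeff₂]

lemma coeff₂_serX_mul (a b : ℕ) (f : PowerSeries (PowerSeries B)) :
    coeff₂ a b (serX B * f) = if 1 ≤ a then coeff₂ (a - 1) b f else 0 := by
  rw [coeff₂, serX, coeff_C_mul]
  cases a <;> simp [coeff₂, coeff_succ_X_mul]

lemma coeff₂_serZ_mul (a b : ℕ) (f : PowerSeries (PowerSeries B)) :
    coeff₂ a b (serZ B * f) = if 1 ≤ b then coeff₂ a (b - 1) f else 0 := by
  rw [coeff₂, serZ]
  cases b <;> simp [coeff₂, coeff_succ_X_mul]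

lemma coeff₂_serX_pow_mul (a b j : ℕ) (f : PowerSeries (PowerSeries B)) :
    coeff₂ a b (serX B ^ j * f) = if j ≤ a then coeff₂ (a - j) b f else 0 := by
  rw [coeff₂, serX, ← map_pow, coeff_C_mul, coeff_X_pow_mul']
  rfl

lemma coeff₂_serZ_pow_mul (a b j : ℕ) (f : PowerSeries (PowerSeries B)) :
    coeff₂ a b (serZ B ^ j * f) = if j ≤ b then coeff₂ a (b - j) f else 0 := by
  rw [coeff₂, serZ, coeff_X_pow_mul']
  split_ifs <;> simp [coeff₂]

lemma coeff₂_one (a b : ℕ) :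
    coeff₂ a b (1 : PowerSeries (PowerSeries B)) = if a = 0 ∧ b = 0 then 1 else 0 := by
  by_cases hb : b = 0 <;> by_cases ha : a = 0 <;> simp [coeff₂, coeff_one, ha, hb]

lemma coeff₂_monomial (a b i j : ℕ) :
    coeff₂ a b (serX B ^ i * serZ B ^ j) = if a = i ∧ b = j then 1 else 0 := by
  rw [coeff₂_serX_pow_mul, ← mul_one (serZ B ^ j), coeff₂_serZ_pow_mul, coeff₂_one]
  split_ifs <;> first | rfl | omega

variable [Algebra ℚ B]

/-- The series with coefficients `e (i + j + 1)`, where `e = newton (-1) p`. -/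
def serT (p : ℕ → B) : PowerSeries (PowerSeries B) :=
  PowerSeries.mk fun j => PowerSeries.mk fun i => newton (-1) p (i + j + 1)

/-- The series `∑ h i x ^ i`. -/
def serH (p : ℕ → B) : PowerSeries (PowerSeries B) := C (newtonSeries 1 p)

/-- The series `∑ e i z ^ i`. -/
def serE (p : ℕ → B) : PowerSeries (PowerSeries B) := map (C (R := B)) (newtonSeries (-1) p)

/-- The generating series of hook characters, multiplied by `x - z`, up to the constant `1`. -/
def serG (ε : ℤ) (p : ℕ → B) : PowerSeries (PowerSeries B) :=
  serW B ε * (serH p * serE p) * serU B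

/-- The generating series of hook characters. -/
def hookSeries (ε : ℤ) (p : ℕ → B) : PowerSeries (PowerSeries B) :=
  -(serW B ε * serT p * serH p + if ε = 1 then serX B else -serZ B) * serU B

/-- The (signed) hook character with arm `α` and leg `β` as a polynomial in power sums. -/
def hook (ε : ℤ) (p : ℕ → B) (α β : ℕ) : B := coeff₂ α β (hookSeries ε p)

lemma coeff₂_serE (p : ℕ → B) (a b : ℕ) :
    coeff₂ a b (serE p) = if a = 0 then newton (-1) p b else 0 := by
  rw [coeff₂, serE, coeff_map, coeff_C, coeff_newtonSeries]

omit [Algebra ℚ B] in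
lemma coeff₂_C (f : PowerSeries B) (a b : ℕ) :
    coeff₂ a b (C f) = if b = 0 then coeff a f else 0 := by
  rw [coeff₂, coeff_C]
  split_ifs <;> simp

lemma coeff₂_serT (p : ℕ → B) (a b : ℕ) : coeff₂ a b (serT p) = newton (-1) p (a + b + 1) := by
  simp [coeff₂, serT]

lemma sub_mul_serT (p : ℕ → B) :
    (serX B - serZ B) * serT p = C (newtonSeries (-1) p) - serE p := by
  ext b a
  change coeff₂ a b _ = coeff₂ a b _
  rw [sub_mul, coeff₂_sub, coeff₂_sub, coeff₂_serX_mul, coeff₂_serZ_mul, coeff₂_serE, coeff₂_C]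
  simp only [coeff₂_serT, coeff_newtonSeries]
  rcases a with _ | a <;> rcases b with _ | b
  · simp
  · simp
  · simp
  · simp [show a + (b + 1) + 1 = a + 1 + b + 1 by ring]

variable [IsDomain B] [CharZero B]

lemma sub_mul_hookSeries {ε : ℤ} (hε : ε = 1 ∨ ε = -1) (p : ℕ → B) :
    (serX B - serZ B) * hookSeries ε p = serG ε p - 1 := by
  have h1 := sub_mul_serT p
  have h2 : serH p * C (newtonSeries (-1) p) = 1 := by
    rw [serH, ← map_mul, newtonSeries_mul_newtonSeries, map_one]
  have h3 := serU_mul (B := B)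
  rw [hookSeries, serG]
  rcases hε with rfl | rfl
  · simp only [serW, if_true]
    linear_combination (-(1 - serX B ^ 2) * serH p * serU B) * h1
      - (1 - serX B ^ 2) * serU B * h2 - h3
  · simp only [serW, if_neg (show ¬ ((-1 : ℤ) = 1) by decide)]
    linear_combination (-(1 - serZ B ^ 2) * serH p * serU B) * h1
      - (1 - serZ B ^ 2) * serU B * h2 - h3

omit [Algebra ℚ B] [IsDomain B] in
lemma serX_sub_serZ_ne_zero : serX B - serZ B ≠ 0 := by
  intro h
  have h1 := congrArg (coeff₂ 1 0) h
  have h2 := coeff₂_monomial (B := B) 1 0 1 0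
  have h3 := coeff₂_monomial (B := B) 1 0 0 1
  simp only [pow_one, pow_zero, mul_one, one_mul] at h2 h3
  rw [coeff₂_sub, h2, h3] at h1
  simp [coeff₂] at h1

section Der

variable {δ : B →+ B} (hδ : IsDer δ) {j : ℕ} (hj : 1 ≤ j) {p : ℕ → B}
  (hp : ∀ i, δ (p i) = if i = j then (j : B) else 0)

include hδ

omit [Algebra ℚ B] [IsDomain B] [CharZero B] in
lemma coeffMap_serX : coeffMap (coeffMap δ) (serX B) = 0 := by
  rw [serX, coeffMap_C, coeffMap_X hδ, map_zero]

omit [Algebra ℚ B] [IsDomain B] [CharZero B] in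
lemma coeffMap_serZ : coeffMap (coeffMap δ) (serZ B) = 0 :=
  coeffMap_X (isDer_coeffMap hδ)

omit [Algebra ℚ B] [IsDomain B] [CharZero B] in
lemma coeffMap_serU : coeffMap (coeffMap δ) (serU B) = 0 := by
  ext n : 1
  simp [serU, (isDer_coeffMap hδ).map_pow_eq_zero (coeffMap_X hδ)]

omit [Algebra ℚ B] [IsDomain B] [CharZero B] in
lemma coeffMap_serW (ε : ℤ) : coeffMap (coeffMap δ) (serW B ε) = 0 := by
  have hD := isDer_coeffMap (isDer_coeffMap hδ)
  rw [serW]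
  split_ifs
  · rw [map_sub, hD.map_one, hD.map_pow_eq_zero (coeffMap_serX hδ), sub_zero]
  · rw [map_sub, hD.map_one, hD.map_pow_eq_zero (coeffMap_serZ hδ), sub_zero]

include hj hp

lemma coeffMap_serG (ε : ℤ) :
    coeffMap (coeffMap δ) (serG ε p) = (serX B ^ j - serZ B ^ j) * serG ε p := by
  have hD := isDer_coeffMap (isDer_coeffMap hδ)
  have hH : coeffMap (coeffMap δ) (serH p) = serX B ^ j * serH p := by
    rw [serH, coeffMap_C, coeffMap_newtonSeries 1 (by decide) p hδ hj hp, serX, ← map_pow,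
      ← map_mul]
    simp
  have hE : coeffMap (coeffMap δ) (serE p) = -(serZ B ^ j * serE p) := by
    rw [serE, coeffMap_map_C, coeffMap_newtonSeries (-1) (by decide) p hδ hj hp, serZ]
    simp
  rw [serG, hD, coeffMap_serU hδ, hD, coeffMap_serW hδ, hD, hH, hE]
  ring

lemma coeffMap_hookSeries {ε : ℤ} (hε : ε = 1 ∨ ε = -1) :
    coeffMap (coeffMap δ) (hookSeries ε p)
      = ∑ i ∈ Finset.range j, serX B ^ i * serZ B ^ (j - 1 - i)
        + (serX B ^ j - serZ B ^ j) * hookSeries ε p := by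
  have hD := isDer_coeffMap (isDer_coeffMap hδ)
  have h := congrArg (coeffMap (coeffMap δ)) (sub_mul_hookSeries hε p)
  rw [hD, map_sub, map_sub, hD.map_one, coeffMap_serX hδ, coeffMap_serZ hδ,
    coeffMap_serG hδ hj hp] at h
  have h1 := Commute.geom_sum₂_mul (Commute.all (serX B) (serZ B)) j
  refine mul_left_cancel₀ (serX_sub_serZ_ne_zero (B := B)) ?_
  linear_combination h - h1 - (serX B ^ j - serZ B ^ j) * sub_mul_hookSeries hε p

lemma der_hook {ε : ℤ} (hε : ε = 1 ∨ ε = -1) (α β : ℕ) :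
    δ (hook ε p α β) = (if j ≤ α then hook ε p (α - j) β else 0)
      - (if j ≤ β then hook ε p α (β - j) else 0) + if j = α + β + 1 then 1 else 0 := by
  have h := congrArg (coeff₂ α β) (coeffMap_hookSeries hδ hj hp hε)
  rw [coeff₂_add, sub_mul, coeff₂_sub, coeff₂_serX_pow_mul, coeff₂_serZ_pow_mul] at h
  have h1 : coeff₂ α β (∑ i ∈ Finset.range j, serX B ^ i * serZ B ^ (j - 1 - i))
      = if j = α + β + 1 then 1 else 0 := by
    have h2 : coeff₂ α β (∑ i ∈ Finset.range j, serX B ^ i * serZ B ^ (j - 1 - i))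
        = ∑ i ∈ Finset.range j, coeff₂ α β (serX B ^ i * serZ B ^ (j - 1 - i)) := by
      simp only [coeff₂, map_sum]
    rw [h2]
    simp only [coeff₂_monomial]
    split_ifs with hjj
    · rw [Finset.sum_eq_single α]
      · rw [if_pos (by omega)]
      · intro i hi hne
        rw [if_neg (by omega)]
      · intro hα
        simp at hα
        omega
    · refine Finset.sum_eq_zero fun i hi => ?_
      simp at hi
      rw [if_neg (by omega)]
  rw [h1] at h
  calc δ (hook ε p α β) = coeff₂ α β (coeffMap (coeffMap δ) (hookSeries ε p)) := by
        simp [hook, coeff₂]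
    _ = _ := by rw [h, hook, hook]; ring

end Der

end Hook

section HookDiagonal

variable {B : Type*} [CommRing B]

/-- The diagonal `f(t, t)` of a double power series. -/
def diagSeries (f : PowerSeries (PowerSeries B)) : PowerSeries B :=
  PowerSeries.mk fun k => ∑ ij ∈ Finset.HasAntidiagonal.antidiagonal k, coeff₂ ij.1 ij.2 f

lemma diagSeries_add (f g : PowerSeries (PowerSeries B)) :
    diagSeries (f + g) = diagSeries f + diagSeries g := by
  ext k
  simp [diagSeries, coeff₂_add, Finset.sum_add_distrib]

lemma diagSeries_neg (f : PowerSeries (PowerSeries B)) :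
    diagSeries (-f) = -diagSeries f := by
  ext k
  simp [diagSeries, coeff₂]

lemma diagSeries_C_mul (v : PowerSeries B) (f : PowerSeries (PowerSeries B)) :
    diagSeries (C v * f) = v * diagSeries f := by
  ext k
  simp only [diagSeries, coeff_mk, coeff₂, coeff_C_mul]
  simp only [coeff_mul, coeff_mk, Finset.mul_sum]
  rw [Finset.sum_sigma', Finset.sum_sigma']
  refine Finset.sum_bij' (fun x _ => ⟨(x.2.1, x.2.2 + x.1.2), (x.2.2, x.1.2)⟩)
    (fun x _ => ⟨(x.1.1 + x.2.1, x.2.2), (x.1.1, x.2.1)⟩) ?_ ?_ ?_ ?_ ?_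
  · rintro ⟨⟨a, b⟩, ⟨c, d⟩⟩ h
    simp at h ⊢
    omega
  · rintro ⟨⟨a, b⟩, ⟨c, d⟩⟩ h
    simp at h ⊢
    omega
  · rintro ⟨⟨a, b⟩, ⟨c, d⟩⟩ h
    simp at h ⊢
    omega
  · rintro ⟨⟨a, b⟩, ⟨c, d⟩⟩ h
    simp at h ⊢
    omega
  · rintro ⟨⟨a, b⟩, ⟨c, d⟩⟩ h
    simp

lemma diagSeries_serX_mul (f : PowerSeries (PowerSeries B)) :
    diagSeries (serX B * f) = X * diagSeries f :=
  diagSeries_C_mul X f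

lemma diagSeries_serZ_mul (f : PowerSeries (PowerSeries B)) :
    diagSeries (serZ B * f) = X * diagSeries f := by
  ext k
  cases k with
  | zero => simp [diagSeries, coeff₂_serZ_mul]
  | succ k =>
    simp [diagSeries, coeff₂_serZ_mul, coeff_succ_X_mul, Finset.Nat.sum_antidiagonal_succ']

lemma diagSeries_one : diagSeries (1 : PowerSeries (PowerSeries B)) = 1 := by
  ext k
  cases k with
  | zero => simp only [diagSeries, coeff_mk, coeff₂_one]; simp [coeff_one, Finset.filter_singleton]
  | succ k =>
    rw [diagSeries, coeff_mk, Finset.sum_eq_zero]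
    · simp [coeff_one]
    · rintro ⟨i, j⟩ h
      simp at h
      rw [coeff₂_one, if_neg (by simp; omega)]

variable [Algebra ℚ B]

lemma coeff_diagSeries_hookSeries (ε : ℤ) (p : ℕ → B) (k : ℕ) :
    coeff k (diagSeries (hookSeries ε p))
      = ∑ ij ∈ Finset.HasAntidiagonal.antidiagonal k, hook ε p ij.1 ij.2 := by
  rw [diagSeries, coeff_mk]
  rfl

lemma X_mul_diagSeries_serT (p : ℕ → B) :
    X * diagSeries (serT p) = euler B (newtonSeries (-1) p) := by
  ext k
  cases k with
  | zero => simp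
  | succ k =>
    rw [coeff_succ_X_mul, coeff_euler, diagSeries, coeff_mk, coeff_newtonSeries]
    rw [Finset.sum_congr rfl (g := fun _ => newton (-1) p (k + 1))]
    · simp
    · rintro ⟨i, j⟩ h
      rw [Finset.HasAntidiagonal.mem_antidiagonal] at h
      simp only at h
      rw [coeff₂_serT, h]

variable [IsDomain B] [CharZero B]

lemma X_mul_diagSeries_hookSeries {ε : ℤ} (hε : ε = 1 ∨ ε = -1) (p : ℕ → B) :
    (1 - X ^ 2) * (X * diagSeries (hookSeries ε p))
      = (1 - X ^ 2) * powerSumSeries p - (ε : PowerSeries B) * X ^ 2 := by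
  have h0 := serU_mul (B := B)
  have hE := euler_newtonSeries (-1) p
  have hHE := newtonSeries_mul_newtonSeries p
  have hT := X_mul_diagSeries_serT p
  have h1 : (hookSeries ε p) + -(serX B * (serZ B * hookSeries ε p))
      = -(serW B ε * (serH p * serT p) + if ε = 1 then serX B else -serZ B) := by
    have : (hookSeries ε p) + -(serX B * (serZ B * hookSeries ε p))
        = hookSeries ε p * (1 - serX B * serZ B) := by ring
    rw [this, hookSeries]
    linear_combination
      -(serW B ε * serT p * serH p + if ε = 1 then serX B else -serZ B) * h0
  have h2 := congrArg diagSeries h1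
  rw [diagSeries_add, diagSeries_neg, diagSeries_serX_mul, diagSeries_serZ_mul, diagSeries_neg,
    diagSeries_add] at h2
  have h3 : diagSeries (serW B ε * (serH p * serT p))
      = (1 - X ^ 2) * (newtonSeries 1 p * diagSeries (serT p)) := by
    rw [serW]
    split_ifs
    · have : (1 - serX B ^ 2) * (serH p * serT p)
          = serH p * serT p + -(serX B * (serX B * (serH p * serT p))) := by ring
      rw [this, diagSeries_add, diagSeries_neg, diagSeries_serX_mul, diagSeries_serX_mul, serH,
        diagSeries_C_mul]
      ring
    · have : (1 - serZ B ^ 2) * (serH p * serT p)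
          = serH p * serT p + -(serZ B * (serZ B * (serH p * serT p))) := by ring
      rw [this, diagSeries_add, diagSeries_neg, diagSeries_serZ_mul, diagSeries_serZ_mul, serH,
        diagSeries_C_mul]
      ring
  have h4 : diagSeries (if ε = 1 then serX B else -serZ B) = (ε : PowerSeries B) * X := by
    have hx : diagSeries (serX B) = X := by
      rw [← mul_one (serX B), diagSeries_serX_mul, diagSeries_one, mul_one]
    have hz : diagSeries (serZ B) = X := by
      rw [← mul_one (serZ B), diagSeries_serZ_mul, diagSeries_one, mul_one]
    rcases hε with rfl | rfl
    · simp [hx]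
    · simp [hz, diagSeries_neg]
  rw [h3, h4] at h2
  push_cast at hE
  linear_combination X * h2 - (1 - X ^ 2) * newtonSeries 1 p * (hT + hE)
    + (1 - X ^ 2) * powerSumSeries p * hHE

lemma sum_hook {ε : ℤ} (hε : ε = 1 ∨ ε = -1) (p : ℕ → B) (k : ℕ) :
    ∑ ij ∈ Finset.HasAntidiagonal.antidiagonal k, hook ε p ij.1 ij.2
      = p (k + 1) - (ε : B) * if Even (k + 1) then 1 else 0 := by
  set Y : PowerSeries B := PowerSeries.mk fun k => if Even k ∧ k ≠ 0 then 1 else 0 with hY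
  have h1 : (1 - X ^ 2) * Y = X ^ 2 := by
    have : Y = X ^ 2 + X ^ 2 * Y := by
      ext k
      rw [map_add, coeff_X_pow_mul', coeff_X_pow]
      rcases k with _ | _ | k
      · simp [hY]
      · simp [hY]
      · rcases k with _ | k
        · simp [hY]
        · simp [hY, Nat.even_add_one]
    linear_combination this
  have hne : (1 - X ^ 2 : PowerSeries B) ≠ 0 := by
    intro h
    have := congrArg (constantCoeff (R := B)) h
    simp at this
  have h2 : X * diagSeries (hookSeries ε p) = powerSumSeries p - (ε : PowerSeries B) * Y := by
    refine mul_left_cancel₀ hne ?_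
    rw [X_mul_diagSeries_hookSeries hε]
    linear_combination (ε : PowerSeries B) * h1
  have h3 := congrArg (coeff (k + 1)) h2
  have hc : (ε : PowerSeries B) = C (ε : B) := by simp
  rw [coeff_succ_X_mul, coeff_diagSeries_hookSeries, map_sub, hc, coeff_C_mul,
    coeff_powerSumSeries] at h3
  simpa [hY] using h3

end HookDiagonal

section Laplacian

variable {B : Type*} [CommRing B]

/-- The first-order coefficient of the loop equation. -/
def loopP (ε : ℤ) (p : ℕ → B) (m : ℕ) : B :=
  ∑ a ∈ Finset.range m, (p a * p (m - a) - ε * p ((m - 2 * a) + (2 * a - m)))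

/-- The second-order coefficient of the loop equation. -/
def loopQ (p : ℕ → B) (i j : ℕ) : B := p ((i - j) + (j - i)) - p (i + j)

/-- The Laplacian truncated at order `J`, acting on polynomials in power sums. -/
def laplacian (ε : ℤ) (p : ℕ → B) (δ : ℕ → B →+ B) (J : ℕ) (f : B) : B :=
  -(∑ j ∈ Finset.Icc 1 J, loopP ε p j * δ j f)
    + ∑ i ∈ Finset.Icc 1 J, ∑ j ∈ Finset.Icc 1 J, loopQ p i j * δ i (δ j f)

/-- The series `∑_m x^m ∑_{a<m} p |m - 2a|`. -/
def serL (p : ℕ → B) : PowerSeries B :=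
  PowerSeries.mk fun m => ∑ a ∈ Finset.range m, p ((m - 2 * a) + (2 * a - m))

lemma serL_eq (p : ℕ → B) :
    (1 - X ^ 2) * serL p = (1 + X ^ 2) * powerSumSeries p + C (p 0) * X ^ 2 := by
  have h : serL p
      = X ^ 2 * serL p + powerSumSeries p + X ^ 2 * powerSumSeries p + C (p 0) * X ^ 2 := by
    ext m
    simp only [map_add, coeff_X_pow_mul', coeff_C_mul, coeff_X_pow, coeff_powerSumSeries, serL,
      coeff_mk]
    rcases m with _ | _ | m
    · simp
    · simp
    · rw [Finset.sum_range_succ', Finset.sum_range_succ]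
      simp only [show 2 ≤ m + 1 + 1 by omega, if_true]
      rw [Finset.sum_congr rfl (g := fun a => p ((m - 2 * a) + (2 * a - m)))]
      · have h1 : m + 1 + 1 - 2 * (m + 1) + (2 * (m + 1) - (m + 1 + 1)) = m := by omega
        rcases m with _ | m
        · simp
          ring
        · simp only [h1]
          simp
          ring
      · intro a _
        congr 1
        omega
  linear_combination h

lemma serP_eq (ε : ℤ) (p : ℕ → B) :
    PowerSeries.mk (loopP ε p) = powerSumSeries p ^ 2 + C (p 0) * powerSumSeries p
      - (ε : PowerSeries B) * serL p := by
  ext m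
  have hc : (ε : PowerSeries B) = C (ε : B) := by simp
  rw [coeff_mk, loopP, map_sub, map_add, hc, coeff_C_mul, coeff_C_mul, serL, coeff_mk, sq,
    coeff_mul, Finset.Nat.sum_antidiagonal_eq_sum_range_succ_mk, Finset.sum_sub_distrib,
    Finset.mul_sum]
  congr 1
  cases m with
  | zero => simp
  | succ m =>
    rw [Finset.sum_range_succ', Finset.sum_range_succ, Finset.sum_range_succ']
    simp only [coeff_powerSumSeries]
    simp
    refine Finset.sum_congr rfl fun a ha => ?_
    simp at ha
    rw [if_neg (by omega)]

lemma serQ_eq (p : ℕ → B) :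
    PowerSeries.mk (fun m => ∑ a ∈ Finset.Ico 1 m, loopQ p a (m - a))
      = serL p - euler B (powerSumSeries p) := by
  ext m
  rw [coeff_mk, map_sub, coeff_euler, serL, coeff_mk, coeff_powerSumSeries]
  cases m with
  | zero => simp
  | succ m =>
    rw [Finset.sum_range_succ', Finset.sum_Ico_eq_sum_range]
    simp only [loopQ, Finset.sum_sub_distrib]
    have h1 : ∀ a ∈ Finset.range (m + 1 - 1),
        p (1 + a - (m + 1 - (1 + a)) + (m + 1 - (1 + a) - (1 + a)))
          = p ((m + 1 - 2 * (a + 1)) + (2 * (a + 1) - (m + 1))) := by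
      intro a ha
      simp at ha
      congr 1
      omega
    have h2 : ∀ a ∈ Finset.range (m + 1 - 1), p (1 + a + (m + 1 - (1 + a))) = p (m + 1) := by
      intro a ha
      simp at ha
      congr 1
      omega
    rw [Finset.sum_congr rfl h1, Finset.sum_congr rfl h2]
    simp
    ring

/-- The series `∑_{i,j ≥ 1} p |i - j| x^i z^j`. -/
def serQ₁ (p : ℕ → B) : PowerSeries (PowerSeries B) :=
  PowerSeries.mk fun j => PowerSeries.mk fun i =>
    if 1 ≤ i ∧ 1 ≤ j then p ((i - j) + (j - i)) else 0

/-- The series `∑_{i,j ≥ 1} p (i + j) x^i z^j`. -/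
def serQ₂ (p : ℕ → B) : PowerSeries (PowerSeries B) :=
  PowerSeries.mk fun j => PowerSeries.mk fun i => if 1 ≤ i ∧ 1 ≤ j then p (i + j) else 0

lemma coeff₂_serQ₁ (p : ℕ → B) (i j : ℕ) :
    coeff₂ i j (serQ₁ p) = if 1 ≤ i ∧ 1 ≤ j then p ((i - j) + (j - i)) else 0 := by
  simp [coeff₂, serQ₁]

lemma coeff₂_serQ₂ (p : ℕ → B) (i j : ℕ) :
    coeff₂ i j (serQ₂ p) = if 1 ≤ i ∧ 1 ≤ j then p (i + j) else 0 := by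
  simp [coeff₂, serQ₂]

lemma coeff₂_C' (f : PowerSeries B) (a b : ℕ) :
    coeff₂ a b (C f) = if b = 0 then coeff a f else 0 := by
  rw [coeff₂, coeff_C]
  split_ifs <;> simp

lemma coeff₂_map_C (f : PowerSeries B) (a b : ℕ) :
    coeff₂ a b (map (C (R := B)) f) = if a = 0 then coeff b f else 0 := by
  rw [coeff₂, coeff_map, coeff_C]

lemma coeff₂_C_C_mul (c : B) (f : PowerSeries (PowerSeries B)) (a b : ℕ) :
    coeff₂ a b (C (C c) * f) = c * coeff₂ a b f := by
  rw [coeff₂, coeff_C_mul, coeff_C_mul, coeff₂]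

lemma serQ₁_eq (p : ℕ → B) :
    (1 - serX B * serZ B) * serQ₁ p = serX B * serZ B *
      (C (C (p 0)) + C (powerSumSeries p) + map (C (R := B)) (powerSumSeries p)) := by
  have h : serQ₁ p = serX B * (serZ B * serQ₁ p) + serX B * (serZ B *
      (C (C (p 0)) + C (powerSumSeries p) + map (C (R := B)) (powerSumSeries p))) := by
    ext j i
    change coeff₂ i j _ = coeff₂ i j _
    simp only [coeff₂_add, coeff₂_serX_mul, coeff₂_serZ_mul, coeff₂_serQ₁, coeff₂_C',
      coeff₂_map_C, coeff_C, coeff_powerSumSeries]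
    rcases i with _ | _ | i <;> rcases j with _ | _ | j <;> simp
  linear_combination h

lemma serQ₂_eq (p : ℕ → B) :
    (serX B - serZ B) * serQ₂ p = serZ B * C (powerSumSeries p)
      - serX B * map (C (R := B)) (powerSumSeries p) := by
  ext j i
  change coeff₂ i j _ = coeff₂ i j _
  simp only [sub_mul, coeff₂_sub, coeff₂_serX_mul, coeff₂_serZ_mul, coeff₂_serQ₂, coeff₂_C',
      coeff₂_map_C, coeff_powerSumSeries]
  rcases i with _ | _ | i <;> rcases j with _ | _ | j <;> simp
  · ring_nf
  · rw [show i + 1 + (j + 1 + 1) = i + 1 + 1 + (j + 1) by ring, sub_self]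

/-- The symbol of the Laplacian on the series `serG`. -/
def serSymbol (ε : ℤ) (p : ℕ → B) : PowerSeries (PowerSeries B) :=
  -C (PowerSeries.mk (loopP ε p)) + map (C (R := B)) (PowerSeries.mk (loopP ε p))
    + C (PowerSeries.mk fun m => ∑ a ∈ Finset.Ico 1 m, loopQ p a (m - a))
    + map (C (R := B)) (PowerSeries.mk fun m => ∑ a ∈ Finset.Ico 1 m, loopQ p a (m - a))
    - 2 * (serQ₁ p - serQ₂ p)

lemma serSymbol_identity_one {K : Type*} [Field K] {x z d R S R' S' L N Q₁ Q₂ G u v : K}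
    (hu : u * (1 - x * z) = 1) (hv : v * (1 - x ^ 2) = 1) (hxz : x - z ≠ 0)
    (hL : (1 - x ^ 2) * L = (1 + x ^ 2) * R + d * x ^ 2)
    (hQ₁ : (1 - x * z) * Q₁ = x * z * (d + R + S))
    (hQ₂ : (x - z) * Q₂ = z * R - x * S)
    (hG : G = -(R ^ 2 + d * R - L) + (S ^ 2 + d * S - N) + (L - R') + (N - S')
      - 2 * (Q₁ - Q₂)) :
    (x - z) * (G + ((d - 1) * (-2 * x ^ 2 * v + R - S + 2 * x * z * u)
      + (-2 * x ^ 2 * v + R + S) * (-2 * x ^ 2 * v + R - S + 2 * x * z * u)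
      + (-4 * x ^ 2 * v ^ 2 + R' + S')))
      = (x + z) * (-2 * x ^ 2 * v + R - S + 2 * x * z * u) := by
  have hu0 : 1 - x * z ≠ 0 := fun h => by simp [h] at hu
  have hv0 : 1 - x ^ 2 ≠ 0 := fun h => by simp [h] at hv
  obtain rfl : u = 1 / (1 - x * z) := by field_simp; exact hu
  obtain rfl : v = 1 / (1 - x ^ 2) := by field_simp; exact hv
  obtain rfl : L = ((1 + x ^ 2) * R + d * x ^ 2) / (1 - x ^ 2) := by
    field_simp; linear_combination hL
  obtain rfl : Q₁ = x * z * (d + R + S) / (1 - x * z) := by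
    field_simp; linear_combination hQ₁
  obtain rfl : Q₂ = (z * R - x * S) / (x - z) := by
    field_simp; linear_combination hQ₂
  subst hG
  field_simp
  ring

lemma serSymbol_identity_neg_one {K : Type*} [Field K] {x z d R S R' S' L N Q₁ Q₂ G u v : K}
    (hu : u * (1 - x * z) = 1) (hv : v * (1 - z ^ 2) = 1) (hxz : x - z ≠ 0)
    (hN : (1 - z ^ 2) * N = (1 + z ^ 2) * S + d * z ^ 2)
    (hQ₁ : (1 - x * z) * Q₁ = x * z * (d + R + S))
    (hQ₂ : (x - z) * Q₂ = z * R - x * S)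
    (hG : G = -(R ^ 2 + d * R + L) + (S ^ 2 + d * S + N) + (L - R') + (N - S')
      - 2 * (Q₁ - Q₂)) :
    (x - z) * (G + ((d + 1) * (-2 * z ^ 2 * v + R - S + 2 * x * z * u)
      + (2 * z ^ 2 * v + R + S) * (-2 * z ^ 2 * v + R - S + 2 * x * z * u)
      + (4 * z ^ 2 * v ^ 2 + R' + S')))
      = (x + z) * (-2 * z ^ 2 * v + R - S + 2 * x * z * u) := by
  have hu0 : 1 - x * z ≠ 0 := fun h => by simp [h] at hu
  have hv0 : 1 - z ^ 2 ≠ 0 := fun h => by simp [h] at hv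
  obtain rfl : u = 1 / (1 - x * z) := by field_simp; exact hu
  obtain rfl : v = 1 / (1 - z ^ 2) := by field_simp; exact hv
  obtain rfl : N = ((1 + z ^ 2) * S + d * z ^ 2) / (1 - z ^ 2) := by
    field_simp; linear_combination hN
  obtain rfl : Q₁ = x * z * (d + R + S) / (1 - x * z) := by
    field_simp; linear_combination hQ₁
  obtain rfl : Q₂ = (z * R - x * S) / (x - z) := by
    field_simp; linear_combination hQ₂
  subst hG
  field_simp
  ring

end Laplacian

section LaplacianHook

lemma IsDer.map_eq_of_mul_one_sub_eq_one {A : Type*} [CommRing A] {D : A →+ A} (hD : IsDer D)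
    {u y : A} (h : u * (1 - y) = 1) : D u = D y * u ^ 2 := by
  have h1 := congrArg D h
  rw [hD, map_sub, hD.map_one] at h1
  linear_combination u * h1 - (D u) * h

variable {B : Type*} [CommRing B]

/-- The Euler operator in the first variable. -/
def eulerX (B : Type*) [CommRing B] :
    PowerSeries (PowerSeries B) →+ PowerSeries (PowerSeries B) := coeffMap (euler B)

/-- The Euler operator in the second variable. -/
def eulerZ (B : Type*) [CommRing B] :
    PowerSeries (PowerSeries B) →+ PowerSeries (PowerSeries B) := euler (PowerSeries B)

lemma isDer_eulerX : IsDer (eulerX B) := isDer_coeffMap (isDer_euler B)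

lemma isDer_eulerZ : IsDer (eulerZ B) := isDer_euler (PowerSeries B)

lemma eulerX_serX : eulerX B (serX B) = serX B := by
  rw [eulerX, serX, coeffMap_C, euler_X]

lemma eulerX_serZ : eulerX B (serZ B) = 0 := coeffMap_X (isDer_euler B)

lemma eulerZ_serX : eulerZ B (serX B) = 0 := euler_C _

lemma eulerZ_serZ : eulerZ B (serZ B) = serZ B := euler_X

lemma eulerX_serX_mul_serZ : eulerX B (serX B * serZ B) = serX B * serZ B := by
  rw [isDer_eulerX, eulerX_serX, eulerX_serZ]; ring

lemma eulerZ_serX_mul_serZ : eulerZ B (serX B * serZ B) = serX B * serZ B := by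
  rw [isDer_eulerZ, eulerZ_serX, eulerZ_serZ]; ring

lemma eulerX_serU : eulerX B (serU B) = serX B * serZ B * serU B ^ 2 := by
  rw [isDer_eulerX.map_eq_of_mul_one_sub_eq_one serU_mul, eulerX_serX_mul_serZ]

lemma eulerZ_serU : eulerZ B (serU B) = serX B * serZ B * serU B ^ 2 := by
  rw [isDer_eulerZ.map_eq_of_mul_one_sub_eq_one serU_mul, eulerZ_serX_mul_serZ]

lemma coeff₂_eulerX (a b : ℕ) (f : PowerSeries (PowerSeries B)) :
    coeff₂ a b (eulerX B f) = a * coeff₂ a b f := by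
  simp [coeff₂, eulerX]

lemma coeff₂_eulerZ (a b : ℕ) (f : PowerSeries (PowerSeries B)) :
    coeff₂ a b (eulerZ B f) = b * coeff₂ a b f := by
  have h : (b : PowerSeries B) = C (b : B) := by simp
  rw [coeff₂, eulerZ, coeff_euler, h, coeff_C_mul, coeff₂]

/-- The series `(1 - X ^ 2)⁻¹`. -/
def geomTwo (B : Type*) [CommRing B] : PowerSeries B :=
  PowerSeries.mk fun k => if Even k then 1 else 0

lemma geomTwo_mul : geomTwo B * (1 - X ^ 2) = 1 := by
  have : geomTwo B = 1 + X ^ 2 * geomTwo B := by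
    ext k
    rw [map_add, coeff_X_pow_mul', coeff_one]
    rcases k with _ | _ | k <;> simp [geomTwo, Nat.even_add_one]
  linear_combination this

lemma eulerX_C (f : PowerSeries B) : eulerX B (C f) = C (euler B f) := by
  rw [eulerX, coeffMap_C]

lemma eulerX_map_C (f : PowerSeries B) : eulerX B (map (C (R := B)) f) = 0 :=
  coeffMap_euler_map_C f

lemma eulerZ_C (f : PowerSeries B) : eulerZ B (C f) = 0 := euler_C f

lemma eulerZ_map_C (f : PowerSeries B) :
    eulerZ B (map (C (R := B)) f) = map (C (R := B)) (euler B f) := euler_map_C f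

lemma IsDer.map_sq {A : Type*} [CommRing A] {D : A →+ A} (hD : IsDer D) (a : A) :
    D (a ^ 2) = 2 * a * D a := by
  rw [sq, hD]; ring

variable [Algebra ℚ B]

lemma eulerX_serH (p : ℕ → B) : eulerX B (serH p) = C (powerSumSeries p) * serH p := by
  rw [eulerX, serH, coeffMap_C, euler_newtonSeries, ← map_mul]
  simp

lemma eulerZ_serH (p : ℕ → B) : eulerZ B (serH p) = 0 := euler_C _

lemma eulerX_serE (p : ℕ → B) : eulerX B (serE p) = 0 := coeffMap_euler_map_C _

lemma eulerZ_serE (p : ℕ → B) :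
    eulerZ B (serE p) = -(map (C (R := B)) (powerSumSeries p) * serE p) := by
  rw [eulerZ, serE, euler_map_C, euler_newtonSeries]
  simp

variable [IsDomain B] [CharZero B]

lemma serSymbol_mul_serG_one (p : ℕ → B) :
    (serX B - serZ B) * (serG 1 p * serSymbol 1 p
      + ((C (C (p 0)) - 1) * (eulerX B (serG 1 p) + eulerZ B (serG 1 p))
      + (eulerX B (eulerX B (serG 1 p) + eulerZ B (serG 1 p))
        - eulerZ B (eulerX B (serG 1 p) + eulerZ B (serG 1 p)))))
      = (serX B + serZ B) * (eulerX B (serG 1 p) + eulerZ B (serG 1 p)) := by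
  set g := serG 1 p with hg
  set x := serX B
  set z := serZ B
  set u := serU B
  set v : PowerSeries (PowerSeries B) := C (geomTwo B)
  set R : PowerSeries (PowerSeries B) := C (powerSumSeries p) with hR
  set S : PowerSeries (PowerSeries B) := map (C (R := B)) (powerSumSeries p) with hS
  set R' : PowerSeries (PowerSeries B) := C (euler B (powerSumSeries p))
  set S' : PowerSeries (PowerSeries B) := map (C (R := B)) (euler B (powerSumSeries p))
  have hv : v * (1 - x ^ 2) = 1 := by
    change C (geomTwo B) * (1 - (C X) ^ 2) = 1
    rw [← map_pow, ← map_one (C (R := PowerSeries B)), ← map_sub, ← map_mul, geomTwo_mul]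
  have hw : serW B 1 = 1 - x ^ 2 := by rw [serW, if_pos rfl]
  have hX := isDer_eulerX (B := B)
  have hZ := isDer_eulerZ (B := B)
  have hxv : eulerX B v = 2 * x ^ 2 * v ^ 2 := by
    rw [hX.map_eq_of_mul_one_sub_eq_one hv, hX.map_sq, eulerX_serX]; ring
  have hzv : eulerZ B v = 0 := eulerZ_C _
  have hgx : eulerX B g = (-2 * x ^ 2 * v + R + x * z * u) * g := by
    rw [hg, serG, hw, hX, eulerX_serU, hX, map_sub, hX.map_one, hX.map_sq, eulerX_serX, hX,
      eulerX_serH, eulerX_serE]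
    linear_combination (2 * x ^ 2 * serH p * serE p * serU B) * hv
  have hgz : eulerZ B g = (-S + x * z * u) * g := by
    rw [hg, serG, hw, hZ, eulerZ_serU, hZ, map_sub, hZ.map_one, hZ.map_sq, eulerZ_serX, hZ,
      eulerZ_serH, eulerZ_serE]
    ring
  have h2 : ∀ {D : PowerSeries (PowerSeries B) →+ PowerSeries (PowerSeries B)}, IsDer D →
      D 2 = 0 := fun {D} hD => by simpa using hD.map_natCast 2
  have hsum : eulerX B g + eulerZ B g = (-2 * x ^ 2 * v + R - S + 2 * x * z * u) * g := by
    rw [hgx, hgz]; ring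
  have hdiff : eulerX B ((-2 * x ^ 2 * v + R - S + 2 * x * z * u) * g)
      - eulerZ B ((-2 * x ^ 2 * v + R - S + 2 * x * z * u) * g)
      = ((-2 * x ^ 2 * v + R + S) * (-2 * x ^ 2 * v + R - S + 2 * x * z * u)
      + (-4 * x ^ 2 * v ^ 2 + R' + S')) * g := by
    rw [hX, hZ, hgx, hgz]
    have e : -2 * x ^ 2 * v + R - S + 2 * x * z * u
        = -(2 * (x ^ 2 * v)) + R - S + 2 * (x * z * u) := by ring
    rw [e]
    simp only [map_add, map_sub, map_neg, hX _ _, hZ _ _, h2 hX, h2 hZ, hX.map_sq, hZ.map_sq, hxv,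
      hzv, eulerX_serX, eulerX_serZ, eulerZ_serX, eulerZ_serZ, x, z, u, R, S, eulerX_serU,
      eulerZ_serU, eulerX_C, eulerX_map_C, eulerZ_C, eulerZ_map_C]
    linear_combination (4 * serX B ^ 2 * v * g) * hv
  rw [hsum, hdiff]
  have key : (x - z) * (serSymbol 1 p + ((C (C (p 0)) - 1)
      * (-2 * x ^ 2 * v + R - S + 2 * x * z * u)
      + (-2 * x ^ 2 * v + R + S) * (-2 * x ^ 2 * v + R - S + 2 * x * z * u)
      + (-4 * x ^ 2 * v ^ 2 + R' + S')))
      = (x + z) * (-2 * x ^ 2 * v + R - S + 2 * x * z * u) := by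
    apply IsFractionRing.injective (PowerSeries (PowerSeries B))
      (FractionRing (PowerSeries (PowerSeries B)))
    set φ := algebraMap (PowerSeries (PowerSeries B)) (FractionRing (PowerSeries (PowerSeries B)))
    have hφ : ∀ {a b}, a = b → φ a = φ b := fun h => congrArg φ h
    have hne : φ x - φ z ≠ 0 := by
      rw [← map_sub]
      exact (map_ne_zero_iff φ (IsFractionRing.injective _ _)).mpr serX_sub_serZ_ne_zero
    have hu' := hφ (serU_mul (B := B))
    have hv' := hφ hv
    have hL' := hφ (congrArg C (serL_eq p))
    have hQ₁' := hφ (serQ₁_eq p)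
    have hQ₂' := hφ (serQ₂_eq p)
    have hG' := hφ (show serSymbol 1 p = _ from by
      rw [serSymbol, serP_eq, serQ_eq])
    have hCX : C (X : PowerSeries B) = serX B := rfl
    have hd : map (C (R := B)) (C (p 0)) = C (C (p 0)) := by
      rw [map_C]
    simp only [map_mul, map_sub, map_add, map_pow, map_one, map_neg, map_ofNat, Int.cast_one,
      one_mul, hd, hCX] at hu' hv' hL' hQ₁' hQ₂' hG' ⊢
    exact serSymbol_identity_one hu' hv' hne hL' hQ₁' hQ₂' hG'
  linear_combination g * key

lemma serSymbol_mul_serG_neg_one (p : ℕ → B) :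
    (serX B - serZ B) * (serG (-1) p * serSymbol (-1) p
      + ((C (C (p 0)) + 1) * (eulerX B (serG (-1) p) + eulerZ B (serG (-1) p))
      + (eulerX B (eulerX B (serG (-1) p) + eulerZ B (serG (-1) p))
        - eulerZ B (eulerX B (serG (-1) p) + eulerZ B (serG (-1) p)))))
      = (serX B + serZ B) * (eulerX B (serG (-1) p) + eulerZ B (serG (-1) p)) := by
  set g := serG (-1) p with hg
  set x := serX B
  set z := serZ B
  set u := serU B
  set v : PowerSeries (PowerSeries B) := map (C (R := B)) (geomTwo B)
  set R : PowerSeries (PowerSeries B) := C (powerSumSeries p) with hR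
  set S : PowerSeries (PowerSeries B) := map (C (R := B)) (powerSumSeries p) with hS
  set R' : PowerSeries (PowerSeries B) := C (euler B (powerSumSeries p))
  set S' : PowerSeries (PowerSeries B) := map (C (R := B)) (euler B (powerSumSeries p))
  have hv : v * (1 - z ^ 2) = 1 := by
    have h : map (C (R := B)) X = serZ B := PowerSeries.map_X _
    rw [show z = map (C (R := B)) X from h.symm, ← map_pow, ← map_one (PowerSeries.map (C (R := B))), ← map_sub, ← map_mul, geomTwo_mul]
  have hw : serW B (-1) = 1 - z ^ 2 := by rw [serW, if_neg (by decide)]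
  have hX := isDer_eulerX (B := B)
  have hZ := isDer_eulerZ (B := B)
  have hzv : eulerZ B v = 2 * z ^ 2 * v ^ 2 := by
    rw [hZ.map_eq_of_mul_one_sub_eq_one hv, hZ.map_sq, eulerZ_serZ]; ring
  have hxv : eulerX B v = 0 := eulerX_map_C _
  have hgx : eulerX B g = (R + x * z * u) * g := by
    rw [hg, serG, hw, hX, eulerX_serU, hX, map_sub, hX.map_one, hX.map_sq, eulerX_serZ, hX,
      eulerX_serH, eulerX_serE]
    ring
  have hgz : eulerZ B g = (-2 * z ^ 2 * v - S + x * z * u) * g := by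
    rw [hg, serG, hw, hZ, eulerZ_serU, hZ, map_sub, hZ.map_one, hZ.map_sq, eulerZ_serZ, hZ,
      eulerZ_serH, eulerZ_serE]
    linear_combination (2 * z ^ 2 * serH p * serE p * serU B) * hv
  have h2 : ∀ {D : PowerSeries (PowerSeries B) →+ PowerSeries (PowerSeries B)}, IsDer D →
      D 2 = 0 := fun {D} hD => by simpa using hD.map_natCast 2
  have hsum : eulerX B g + eulerZ B g = (-2 * z ^ 2 * v + R - S + 2 * x * z * u) * g := by
    rw [hgx, hgz]; ring
  have hdiff : eulerX B ((-2 * z ^ 2 * v + R - S + 2 * x * z * u) * g)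
      - eulerZ B ((-2 * z ^ 2 * v + R - S + 2 * x * z * u) * g)
      = ((2 * z ^ 2 * v + R + S) * (-2 * z ^ 2 * v + R - S + 2 * x * z * u)
      + (4 * z ^ 2 * v ^ 2 + R' + S')) * g := by
    rw [hX, hZ, hgx, hgz]
    have e : -2 * z ^ 2 * v + R - S + 2 * x * z * u
        = -(2 * (z ^ 2 * v)) + R - S + 2 * (x * z * u) := by ring
    rw [e]
    simp only [map_add, map_sub, map_neg, hX _ _, hZ _ _, h2 hX, h2 hZ, hX.map_sq, hZ.map_sq, hxv,
      hzv, eulerX_serX, eulerX_serZ, eulerZ_serX, eulerZ_serZ, x, z, u, R, S, eulerX_serU,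
      eulerZ_serU, eulerX_C, eulerX_map_C, eulerZ_C, eulerZ_map_C]
    linear_combination (-4 * serZ B ^ 2 * v * g) * hv
  rw [hsum, hdiff]
  have key : (x - z) * (serSymbol (-1) p + ((C (C (p 0)) + 1)
      * (-2 * z ^ 2 * v + R - S + 2 * x * z * u)
      + (2 * z ^ 2 * v + R + S) * (-2 * z ^ 2 * v + R - S + 2 * x * z * u)
      + (4 * z ^ 2 * v ^ 2 + R' + S')))
      = (x + z) * (-2 * z ^ 2 * v + R - S + 2 * x * z * u) := by
    apply IsFractionRing.injective (PowerSeries (PowerSeries B))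
      (FractionRing (PowerSeries (PowerSeries B)))
    set φ := algebraMap (PowerSeries (PowerSeries B)) (FractionRing (PowerSeries (PowerSeries B)))
    have hφ : ∀ {a b}, a = b → φ a = φ b := fun h => congrArg φ h
    have hne : φ x - φ z ≠ 0 := by
      rw [← map_sub]
      exact (map_ne_zero_iff φ (IsFractionRing.injective _ _)).mpr serX_sub_serZ_ne_zero
    have hu' := hφ (serU_mul (B := B))
    have hv' := hφ hv
    have hL' := hφ (congrArg (PowerSeries.map (C (R := B))) (serL_eq p))
    have hQ₁' := hφ (serQ₁_eq p)
    have hQ₂' := hφ (serQ₂_eq p)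
    have hG' := hφ (show serSymbol (-1) p = _ from by
      rw [serSymbol, serP_eq, serQ_eq])
    have hCX : (X : PowerSeries (PowerSeries B)) = serZ B := rfl
    have hd : map (C (R := B)) (C (p 0)) = C (C (p 0)) := by
      rw [map_C]
    simp only [map_mul, map_sub, map_add, map_pow, map_one, map_neg, map_ofNat, Int.cast_one, Int.cast_neg, PowerSeries.map_X,
      one_mul, neg_mul, sub_neg_eq_add, hd, hCX] at hu' hv' hL' hQ₁' hQ₂' hG' ⊢
    have := serSymbol_identity_neg_one hu' hv' hne hL' hQ₁' hQ₂' hG'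
    simpa only [neg_mul] using this
  linear_combination g * key

end LaplacianHook

section LaplacianEigen

variable {B : Type*} [CommRing B]

lemma coeff₂_mul_congr {a b : ℕ} (g : PowerSeries (PowerSeries B))
    {S S' : PowerSeries (PowerSeries B)}
    (h : ∀ α ≤ a, ∀ β ≤ b, coeff₂ α β S = coeff₂ α β S') :
    coeff₂ a b (g * S) = coeff₂ a b (g * S') := by
  simp only [coeff₂, coeff_mul, map_sum]
  refine Finset.sum_congr rfl fun x hx => Finset.sum_congr rfl fun y hy => ?_
  rw [Finset.HasAntidiagonal.mem_antidiagonal] at hx hy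
  have := h y.2 (by omega) x.2 (by omega)
  simp only [coeff₂] at this
  rw [this]

lemma coeff₂_sum {ι : Type*} (s : Finset ι) (f : ι → PowerSeries (PowerSeries B)) (a b : ℕ) :
    coeff₂ a b (∑ i ∈ s, f i) = ∑ i ∈ s, coeff₂ a b (f i) := by
  simp only [coeff₂, map_sum]

lemma coeff₂_neg (a b : ℕ) (f : PowerSeries (PowerSeries B)) :
    coeff₂ a b (-f) = -coeff₂ a b f := by simp [coeff₂]

/-- The truncation of `serSymbol` at order `J`. -/
def serSymbolTrunc (ε : ℤ) (p : ℕ → B) (J : ℕ) : PowerSeries (PowerSeries B) :=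
  -(∑ j ∈ Finset.Icc 1 J, C (C (loopP ε p j)) * (serX B ^ j - serZ B ^ j))
    + ∑ i ∈ Finset.Icc 1 J, ∑ j ∈ Finset.Icc 1 J,
      C (C (loopQ p i j)) * ((serX B ^ i - serZ B ^ i) * (serX B ^ j - serZ B ^ j))

lemma sum_Icc_ite_eq (J a : ℕ) (q : Prop) [Decidable q] (f : ℕ → B) (ha : a ≤ J) :
    ∑ j ∈ Finset.Icc 1 J, f j * (if a = j ∧ q then 1 else 0)
      = if 1 ≤ a ∧ q then f a else 0 := by
  rcases Nat.eq_zero_or_pos a with rfl | h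
  · rw [if_neg (by omega)]
    refine Finset.sum_eq_zero fun j hj => ?_
    simp at hj
    rw [if_neg (by omega), mul_zero]
  · rw [Finset.sum_eq_single a]
    · by_cases hq : q <;> simp [hq, h.ne', Nat.one_le_iff_ne_zero]
    · intro j _ hj
      rw [if_neg (fun h => hj h.1.symm), mul_zero]
    · intro h'
      simp at h'
      omega

lemma sum_Icc_Icc_ite_add (J a : ℕ) (q : Prop) [Decidable q] (f : ℕ → ℕ → B) (ha : a ≤ J) :
    ∑ i ∈ Finset.Icc 1 J, ∑ j ∈ Finset.Icc 1 J, f i j * (if a = i + j ∧ q then 1 else 0)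
      = if q then ∑ i ∈ Finset.Ico 1 a, f i (a - i) else 0 := by
  by_cases hq : q
  · rw [if_pos hq]
    symm
    refine Finset.sum_subset_zero_on_sdiff (fun i hi => ?_) (fun i hi => ?_) (fun i hi => ?_)
    · simp at hi ⊢; omega
    · simp at hi
      refine Finset.sum_eq_zero fun j hj => ?_
      simp at hj
      rw [if_neg (by omega), mul_zero]
    · simp at hi
      rw [Finset.sum_eq_single (a - i)]
      · rw [if_pos ⟨by omega, hq⟩, mul_one]
      · intro j _ hj
        rw [if_neg (by omega), mul_zero]
      · intro h
        simp at h
        omega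
  · simp [hq]

lemma loopQ_comm (p : ℕ → B) (i j : ℕ) : loopQ p i j = loopQ p j i := by
  rw [loopQ, loopQ, add_comm (i - j), add_comm i j]

lemma coeff₂_serSymbolTrunc (ε : ℤ) (p : ℕ → B) {J α β : ℕ} (h : α + β ≤ J) :
    coeff₂ α β (serSymbolTrunc ε p J) = coeff₂ α β (serSymbol ε p) := by
  have hx : ∀ j, coeff₂ α β (serX B ^ j) = if α = j ∧ β = 0 then 1 else 0 := fun j => by
    simpa using coeff₂_monomial (B := B) α β j 0
  have hz : ∀ j, coeff₂ α β (serZ B ^ j) = if β = j ∧ α = 0 then 1 else 0 := fun j => by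
    simpa [and_comm] using coeff₂_monomial (B := B) α β 0 j
  have e : ∀ i j, (serX B ^ i - serZ B ^ i) * (serX B ^ j - serZ B ^ j)
      = serX B ^ (i + j) - serX B ^ i * serZ B ^ j - serX B ^ j * serZ B ^ i
        + serZ B ^ (i + j) := fun i j => by ring
  have h1 : ∑ j ∈ Finset.Icc 1 J, loopP ε p j * (if α = j ∧ β = 0 then 1 else 0)
      = if β = 0 then loopP ε p α else 0 := by
    rw [sum_Icc_ite_eq J α _ _ (by omega)]
    rcases α with _ | α <;> simp [loopP]
  have h2 : ∑ j ∈ Finset.Icc 1 J, loopP ε p j * (if β = j ∧ α = 0 then 1 else 0)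
      = if α = 0 then loopP ε p β else 0 := by
    rw [sum_Icc_ite_eq J β _ _ (by omega)]
    rcases β with _ | β <;> simp [loopP]
  have h3 : ∀ a b, a ≤ J → b ≤ J → ∑ i ∈ Finset.Icc 1 J, ∑ j ∈ Finset.Icc 1 J,
      loopQ p i j * (if a = i ∧ b = j then 1 else 0)
      = if 1 ≤ a ∧ 1 ≤ b then loopQ p a b else 0 := by
    intro a b ha hb
    have : ∀ i, ∑ j ∈ Finset.Icc 1 J, loopQ p i j * (if a = i ∧ b = j then 1 else 0)
        = loopQ p i b * (if a = i ∧ 1 ≤ b then 1 else 0) := by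
      intro i
      simp only [and_comm (a := a = i)]
      rw [sum_Icc_ite_eq J b _ _ hb]
      by_cases h' : a = i <;> by_cases h'' : 1 ≤ b <;> simp [h', h'']
    simp only [this]
    rw [sum_Icc_ite_eq J a _ (fun i => loopQ p i b) ha]
  have h4 : ∑ i ∈ Finset.Icc 1 J, ∑ j ∈ Finset.Icc 1 J,
      loopQ p i j * (if α = j ∧ β = i then 1 else 0)
      = if 1 ≤ α ∧ 1 ≤ β then loopQ p α β else 0 := by
    simp only [and_comm (a := α = _)]
    rw [h3 β α (by omega) (by omega), loopQ_comm]
    simp only [and_comm]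
  rw [serSymbolTrunc, serSymbol]
  have h5 : (2 : PowerSeries (PowerSeries B)) * (serQ₁ p - serQ₂ p)
    = (serQ₁ p - serQ₂ p) + (serQ₁ p - serQ₂ p) := two_mul _
  rw [h5]
  simp only [coeff₂_add, coeff₂_neg, coeff₂_sum, coeff₂_C_C_mul, coeff₂_sub, e, hx, hz,
    coeff₂_monomial, mul_sub, mul_add, Finset.sum_sub_distrib, Finset.sum_add_distrib, h1, h2,
    h3 α β (by omega) (by omega), h4, sum_Icc_Icc_ite_add J α _ _ (by omega : α ≤ J),
    sum_Icc_Icc_ite_add J β _ _ (by omega : β ≤ J), coeff₂_C', coeff₂_map_C, coeff_mk,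
    coeff₂_serQ₁, coeff₂_serQ₂]
  by_cases hαβ : 1 ≤ α ∧ 1 ≤ β
  · simp only [if_pos hαβ, loopQ]
    ring
  · simp only [if_neg hαβ]
    ring

variable {p : ℕ → B} {δ : ℕ → B →+ B}

lemma laplacian_add (ε : ℤ) (J : ℕ) (f g : B) :
    laplacian ε p δ J (f + g) = laplacian ε p δ J f + laplacian ε p δ J g := by
  simp only [laplacian, map_add, mul_add, Finset.sum_add_distrib]
  ring

lemma laplacian_sub (ε : ℤ) (J : ℕ) (f g : B) :
    laplacian ε p δ J (f - g) = laplacian ε p δ J f - laplacian ε p δ J g := by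
  simp only [laplacian, map_sub, mul_sub, Finset.sum_sub_distrib]
  ring

lemma laplacian_one (hδ : ∀ j, IsDer (δ j)) (ε : ℤ) (J : ℕ) : laplacian ε p δ J 1 = 0 := by
  simp [laplacian, (hδ _).map_one]

lemma laplacian_zero (ε : ℤ) (J : ℕ) : laplacian ε p δ J 0 = 0 := by
  simp [laplacian]

lemma der_coeff₂ (D : B →+ B) (a b : ℕ) (f : PowerSeries (PowerSeries B)) :
    D (coeff₂ a b f) = coeff₂ a b (coeffMap (coeffMap D) f) := by
  simp [coeff₂]

variable [Algebra ℚ B] [IsDomain B] [CharZero B]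
variable (hδ : ∀ j, IsDer (δ j))
  (hp : ∀ j, 1 ≤ j → ∀ i, δ j (p i) = if i = j then (j : B) else 0)

include hδ hp

lemma laplacian_serG (ε : ℤ) {J a b : ℕ} (h : a + b ≤ J) :
    laplacian ε p δ J (coeff₂ a b (serG ε p)) = coeff₂ a b (serG ε p * serSymbol ε p) := by
  rw [← coeff₂_mul_congr (S := serSymbolTrunc ε p J) (serG ε p)
    (fun α hα β hβ => coeff₂_serSymbolTrunc ε p (by omega))]
  have h1 : ∀ j ∈ Finset.Icc 1 J, ∀ a b, δ j (coeff₂ a b (serG ε p))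
      = coeff₂ a b ((serX B ^ j - serZ B ^ j) * serG ε p) := by
    intro j hj a b
    simp at hj
    rw [der_coeff₂, coeffMap_serG (hδ j) hj.1 (hp j hj.1)]
  have h2 : ∀ i ∈ Finset.Icc 1 J, ∀ j ∈ Finset.Icc 1 J, δ i (δ j (coeff₂ a b (serG ε p)))
      = coeff₂ a b ((serX B ^ i - serZ B ^ i) * (serX B ^ j - serZ B ^ j) * serG ε p) := by
    intro i hi j hj
    rw [h1 j hj]
    simp at hi hj
    have hD := isDer_coeffMap (isDer_coeffMap (hδ i))
    rw [der_coeff₂, hD, coeffMap_serG (hδ i) hi.1 (hp i hi.1), map_sub,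
      hD.map_pow_eq_zero (coeffMap_serX (hδ i)), hD.map_pow_eq_zero (coeffMap_serZ (hδ i))]
    congr 1
    ring
  rw [laplacian, serSymbolTrunc, mul_add, mul_neg, Finset.mul_sum, Finset.mul_sum, coeff₂_add,
    coeff₂_neg, coeff₂_sum, coeff₂_sum]
  congr 1
  · congr 1
    refine Finset.sum_congr rfl fun j hj => ?_
    rw [h1 j hj, ← coeff₂_C_C_mul]
    congr 1
    ring
  · refine Finset.sum_congr rfl fun i hi => ?_
    rw [Finset.mul_sum, coeff₂_sum]
    refine Finset.sum_congr rfl fun j hj => ?_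
    rw [h2 i hi j hj, ← coeff₂_C_C_mul]
    congr 1
    ring

omit hδ hp in
lemma serSymbol_mul_serG {ε : ℤ} (hε : ε = 1 ∨ ε = -1) (p : ℕ → B) :
    (serX B - serZ B) * (serG ε p * serSymbol ε p
      + ((C (C (p 0)) - C (C (ε : B))) * (eulerX B (serG ε p) + eulerZ B (serG ε p))
      + (eulerX B (eulerX B (serG ε p) + eulerZ B (serG ε p))
        - eulerZ B (eulerX B (serG ε p) + eulerZ B (serG ε p)))))
      = (serX B + serZ B) * (eulerX B (serG ε p) + eulerZ B (serG ε p)) := by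
  rcases hε with rfl | rfl
  · simpa using serSymbol_mul_serG_one p
  · simpa using serSymbol_mul_serG_neg_one p

omit hδ hp in
lemma coeff₂_serG {ε : ℤ} (hε : ε = 1 ∨ ε = -1) (p : ℕ → B) (a b : ℕ) :
    coeff₂ a b (serG ε p) = (if 1 ≤ a then hook ε p (a - 1) b else 0)
      - (if 1 ≤ b then hook ε p a (b - 1) else 0) + if a = 0 ∧ b = 0 then 1 else 0 := by
  have h := congrArg (coeff₂ a b) (sub_mul_hookSeries hε p)
  rw [sub_mul, coeff₂_sub, coeff₂_sub, coeff₂_serX_mul, coeff₂_serZ_mul, coeff₂_one] at h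
  rw [hook, hook, h]
  ring

omit hδ hp in
lemma serG_mul_serSymbol {ε : ℤ} (hε : ε = 1 ∨ ε = -1) (p : ℕ → B) :
    ∃ W : PowerSeries (PowerSeries B),
      (∀ a b, coeff₂ a b W = ((a : B) + b + 1) * (p 0 - ε + a - b) * hook ε p a b) ∧
      serG ε p * serSymbol ε p = -((serX B - serZ B) * W) := by
  set O := hookSeries ε p with hO
  set Y := eulerX B O + eulerZ B O + O with hY
  have hX := isDer_eulerX (B := B)
  have hZ := isDer_eulerZ (B := B)
  have hG : serG ε p = (serX B - serZ B) * O + 1 := by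
    rw [sub_mul_hookSeries hε]; ring
  have h1 : eulerX B (serG ε p) + eulerZ B (serG ε p) = (serX B - serZ B) * Y := by
    rw [hG, map_add, map_add, hX, hZ, hX.map_one, hZ.map_one, map_sub, map_sub, eulerX_serX,
      eulerX_serZ, eulerZ_serX, eulerZ_serZ]
    ring
  refine ⟨(C (C (p 0)) - C (C (ε : B))) * Y + (eulerX B Y - eulerZ B Y), ?_, ?_⟩
  · intro a b
    have hb : coeff₂ a b Y = ((a : B) + b + 1) * hook ε p a b := by
      rw [hY, coeff₂_add, coeff₂_add, coeff₂_eulerX, coeff₂_eulerZ, hook]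
      ring
    rw [coeff₂_add, sub_mul, coeff₂_sub, coeff₂_sub, coeff₂_C_C_mul, coeff₂_C_C_mul,
      coeff₂_eulerX, coeff₂_eulerZ, hb]
    ring
  · have h2 := serSymbol_mul_serG hε p
    rw [h1, hX, hZ, map_sub, map_sub, eulerX_serX, eulerX_serZ, eulerZ_serX, eulerZ_serZ] at h2
    refine mul_left_cancel₀ (serX_sub_serZ_ne_zero (B := B)) ?_
    linear_combination h2

lemma laplacian_hook {ε : ℤ} (hε : ε = 1 ∨ ε = -1) {J : ℕ} (α β : ℕ) (h : α + β + 1 ≤ J) :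
    laplacian ε p δ J (hook ε p α β)
      = -(((α : B) + β + 1) * (p 0 - ε + α - β) * hook ε p α β) := by
  obtain ⟨W, hW, hGW⟩ := serG_mul_serSymbol hε p
  have step : ∀ a b, a + b ≤ J →
      (if 1 ≤ a then laplacian ε p δ J (hook ε p (a - 1) b) + coeff₂ (a - 1) b W else 0)
      - (if 1 ≤ b then laplacian ε p δ J (hook ε p a (b - 1)) + coeff₂ a (b - 1) W else 0)
      = 0 := by
    intro a b hab
    have h1 := laplacian_serG hδ hp ε hab
    rw [coeff₂_serG hε, laplacian_add, laplacian_sub, hGW, coeff₂_neg, sub_mul, coeff₂_sub,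
      coeff₂_serX_mul, coeff₂_serZ_mul] at h1
    have h2 : laplacian ε p δ J (if a = 0 ∧ b = 0 then 1 else 0) = 0 := by
      split_ifs
      · exact laplacian_one hδ ε J
      · exact laplacian_zero ε J
    rw [h2] at h1
    split_ifs at h1 ⊢ <;> (try simp only [laplacian_zero] at h1) <;> linear_combination h1
  have main : ∀ α β, α + β + 1 ≤ J →
      laplacian ε p δ J (hook ε p α β) + coeff₂ α β W = 0 := by
    intro α
    induction α with
    | zero =>
      intro β hβ
      have := step 0 (β + 1) (by omega)
      simp only [Nat.le_add_left, if_true, add_tsub_cancel_right, if_neg (show ¬ 1 ≤ 0 by omega)]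
        at this
      linear_combination -this
    | succ α ih =>
      intro β hβ
      have h1 := step (α + 1) (β + 1) (by omega)
      have h2 := ih (β + 1) (by omega)
      simp only [Nat.le_add_left, if_true, add_tsub_cancel_right] at h1
      linear_combination h2 - h1
  have := main α β h
  rw [hW] at this
  linear_combination this

end LaplacianEigen

end

section Moments

lemma sum_Icc_ite_two_mul (α : ℕ) (N : ℤ) :
    ∑ j ∈ Finset.Icc 1 α, (if 2 * (j : ℤ) = N then (1 : ℤ) else 0)
      = if N % 2 = 0 ∧ 2 ≤ N ∧ N ≤ 2 * α then 1 else 0 := by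
  split_ifs with h
  · rw [Finset.sum_eq_single (N / 2).toNat]
    · rw [if_pos (by omega)]
    · intro j _ hj
      rw [if_neg (by omega)]
    · intro h'
      simp at h'
      omega
  · refine Finset.sum_eq_zero fun j hj => ?_
    simp at hj
    rw [if_neg (by omega)]

lemma sum_arm_indicator (α c m : ℕ) (hc : α < c) :
    ∑ j ∈ Finset.Icc 1 α, ((if (m - j) + (j - m) + j = c then (1 : ℤ) else 0)
        - if m + j + j = c then 1 else 0)
      = (if m = c then (α : ℤ) else 0)
        + (if (c + m) % 2 = 0 ∧ m < c ∧ c + m ≤ 2 * α then 1 else 0)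
        - if (c + m) % 2 = 0 ∧ m < c ∧ c ≤ m + 2 * α then 1 else 0 := by
  have h : ∀ j ∈ Finset.Icc 1 α, ((if (m - j) + (j - m) + j = c then (1 : ℤ) else 0)
        - if m + j + j = c then 1 else 0)
      = (if m = c then 1 else 0) + (if m < c then 1 else 0) *
        (if 2 * (j : ℤ) = c + m then (1 : ℤ) else 0)
        - (if 2 * (j : ℤ) = c - m then (1 : ℤ) else 0) := by
    intro j hj
    simp at hj
    split_ifs <;> omega
  rw [Finset.sum_congr rfl h, Finset.sum_sub_distrib, Finset.sum_add_distrib, ← Finset.mul_sum,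
    sum_Icc_ite_two_mul, sum_Icc_ite_two_mul]
  simp only [Finset.sum_const, Nat.card_Icc, add_tsub_cancel_right, smul_ite, nsmul_zero, nsmul_one]
  split_ifs <;> omega

lemma sum_leg_indicator (β c m : ℕ) (hc : 0 < c) :
    ∑ j ∈ Finset.Icc 1 β, ((if (m - j) + (j - m) = c + j then (1 : ℤ) else 0)
        - if m + j = c + j then 1 else 0)
      = (if (c + m) % 2 = 0 ∧ c < m ∧ m ≤ c + 2 * β then 1 else 0)
        - if m = c then (β : ℤ) else 0 := by
  have h : ∀ j ∈ Finset.Icc 1 β, ((if (m - j) + (j - m) = c + j then (1 : ℤ) else 0)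
        - if m + j = c + j then 1 else 0)
      = (if 2 * (j : ℤ) = m - c then (1 : ℤ) else 0) - (if m = c then 1 else 0) := by
    intro j hj
    simp at hj
    split_ifs <;> omega
  rw [Finset.sum_congr rfl h, Finset.sum_sub_distrib, sum_Icc_ite_two_mul]
  simp only [Finset.sum_const, Nat.card_Icc, add_tsub_cancel_right, smul_ite, nsmul_zero, nsmul_one]
  split_ifs <;> omega

lemma moment_identity_zero (α β m M : ℕ) (hm : 1 ≤ m) :
    ∑ j ∈ Finset.Icc 1 α, ((if (m - j) + (j - m) + j = α + β + 1 then (1 : ℤ) else 0)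
        - if m + j + j = α + β + 1 then 1 else 0)
      - ∑ j ∈ Finset.Icc 1 β, ((if (m - j) + (j - m) + j = α + β + 1 then (1 : ℤ) else 0)
        - if m + j + j = α + β + 1 then 1 else 0)
      + (if m = α + β + 1 then (M : ℤ) else 0)
      = (if m = α + β + 1 then (α + M - β : ℤ) else 0) := by
  rw [sum_arm_indicator _ _ _ (by omega), sum_arm_indicator _ _ _ (by omega)]
  by_cases h1 : m = α + β + 1
  · simp only [if_pos h1]
    split_ifs <;> omega
  · simp only [if_neg h1]
    split_ifs <;> omega

lemma moment_identity_one (α β m M : ℕ) (hm : 1 ≤ m) (hβ : β < M) :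
    -∑ j ∈ Finset.Icc 1 α, ((if (m - j) + (j - m) + j = α + M - β then (1 : ℤ) else 0)
        - if m + j + j = α + M - β then 1 else 0)
      + ∑ j ∈ Finset.Icc 1 β, ((if (m - j) + (j - m) = (α + M - β) + j then (1 : ℤ) else 0)
        - if m + j = (α + M - β) + j then 1 else 0)
      + ((if M + 1 ≤ (m - (α + β + 1)) + (α + β + 1 - m)
            ∧ ((m - (α + β + 1)) + (α + β + 1 - m) + M + 1) % 2 = 0 then 1 else 0)
        - if M + 1 ≤ m + (α + β + 1) ∧ (m + (α + β + 1) + M + 1) % 2 = 0 then 1 else 0)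
      = -(if m = α + M - β then (α + β + 1 : ℤ) else 0) := by
  rw [sum_arm_indicator _ _ _ (by omega), sum_leg_indicator _ _ _ (by omega)]
  by_cases h1 : m = α + M - β
  · simp only [if_pos h1]
    split_ifs <;> omega
  · simp only [if_neg h1]
    split_ifs <;> omega

end Moments

section LoopFunctional

variable {B : Type*} [CommRing B] [Algebra ℚ B] [IsDomain B] [CharZero B]

/-- A positive functional on a ring generated by power sums satisfying the loop equations. -/
structure IsLoopFunctional (ε : ℤ) (M : ℕ) (p : ℕ → B) (δ : ℕ → B →+ B) (E : B →+ ℝ) : Prop where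
  sign : ε = 1 ∨ ε = -1
  isDer : ∀ j, IsDer (δ j)
  der_apply : ∀ j, 1 ≤ j → ∀ i, δ j (p i) = if i = j then (j : B) else 0
  apply_zero : p 0 = (M : B) + ε
  map_one : E 1 = 1
  map_mul_self_nonneg : ∀ f, 0 ≤ E (f * f)
  map_loopP : ∀ (f : B) (J m : ℕ), 1 ≤ m → (∀ j, J < j → δ j f = 0) →
    E (f * loopP ε p m) = ∑ j ∈ Finset.Icc 1 J, E (δ j f * loopQ p m j)
  map_hook_mul : ∀ (α β : ℕ) (f : B), M ≤ β →
    E (hook ε p α β * f) = if α + M = β then E (hook ε p 0 M * f) else 0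
  map_hook_mul_self : E (hook ε p 0 M * hook ε p 0 M) ≤ 1

lemma sum_antidiagonal_ite_add (k M : ℕ) (c : ℝ) :
    ∑ ij ∈ Finset.HasAntidiagonal.antidiagonal k, (if ij.1 + M = ij.2 then c else 0)
      = if M ≤ k ∧ (k + M) % 2 = 0 then c else 0 := by
  split_ifs with h
  · rw [Finset.sum_eq_single ((k - M) / 2, k - (k - M) / 2)]
    · rw [if_pos (by simp only; omega)]
    · rintro ⟨a, b⟩ hab hne
      rw [Finset.HasAntidiagonal.mem_antidiagonal] at hab
      simp only at hab
      refine if_neg fun h' => hne ?_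
      simp only at h'
      rw [Prod.mk.injEq]
      omega
    · intro h'
      rw [Finset.HasAntidiagonal.mem_antidiagonal] at h'
      simp only at h'
      omega
  · refine Finset.sum_eq_zero ?_
    rintro ⟨a, b⟩ hab
    rw [Finset.HasAntidiagonal.mem_antidiagonal] at hab
    simp only at hab ⊢
    exact if_neg (by omega)

lemma sum_Icc_ite_le {R : Type*} [AddCommMonoid R] {a J : ℕ} (h : a ≤ J) (f : ℕ → R) :
    ∑ j ∈ Finset.Icc 1 J, (if j ≤ a then f j else 0) = ∑ j ∈ Finset.Icc 1 a, f j := by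
  rw [← Finset.sum_filter]
  refine Finset.sum_congr ?_ fun _ _ => rfl
  ext j
  simp only [Finset.mem_filter, Finset.mem_Icc]
  omega

namespace IsLoopFunctional

variable {ε : ℤ} {M : ℕ} {p : ℕ → B} {δ : ℕ → B →+ B} {E : B →+ ℝ}

omit [Algebra ℚ B] [IsDomain B] [CharZero B] in
lemma map_intCast_mul (E : B →+ ℝ) (c : ℤ) (f : B) : E ((c : B) * f) = c * E f := by
  rw [← zsmul_eq_mul, map_zsmul, zsmul_eq_mul]

variable (hE : IsLoopFunctional ε M p δ E)
include hE

lemma der_hook_eq_zero {α β j : ℕ} (hj : α + β + 1 < j) : δ j (hook ε p α β) = 0 := by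
  rw [der_hook (hE.isDer j) (by omega) (hE.der_apply j (by omega)) hE.sign, if_neg (by omega),
    if_neg (by omega), if_neg (by omega)]
  simp

lemma der_der_hook_eq_zero {α β i j : ℕ} (hj : 1 ≤ j) (hi : α + β + 1 < i) :
    δ i (δ j (hook ε p α β)) = 0 := by
  rw [der_hook (hE.isDer j) hj (hE.der_apply j hj) hE.sign, map_add, map_sub]
  have h1 : δ i (if j ≤ α then hook ε p (α - j) β else 0) = 0 := by
    split_ifs
    · exact hE.der_hook_eq_zero (by omega)
    · exact map_zero _
  have h2 : δ i (if j ≤ β then hook ε p α (β - j) else 0) = 0 := by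
    split_ifs
    · exact hE.der_hook_eq_zero (by omega)
    · exact map_zero _
  have h3 : δ i (if j = α + β + 1 then 1 else 0) = 0 := by
    split_ifs
    · exact (hE.isDer i).map_one
    · exact map_zero _
  rw [h1, h2, h3]
  simp

lemma eigen_mul {α β J : ℕ} (hJ : α + β + 1 ≤ J) {t : B} (ht : ∀ i, J < i → δ i t = 0) :
    ((α : ℝ) + β + 1) * (M + α - β) * E (hook ε p α β * t)
      = ∑ j ∈ Finset.Icc 1 J, ∑ i ∈ Finset.Icc 1 J,
        E (loopQ p i j * δ j (hook ε p α β) * δ i t) := by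
  set σ := hook ε p α β with hσ
  have h1 := laplacian_hook hE.isDer hE.der_apply hE.sign α β hJ
  rw [hE.apply_zero, ← hσ, laplacian] at h1
  have h2 : (((((α : ℤ) + β + 1) * (M + α - β) : ℤ) : B)) * (σ * t)
      = ∑ j ∈ Finset.Icc 1 J, (δ j σ * t) * loopP ε p j
        - ∑ i ∈ Finset.Icc 1 J, ∑ j ∈ Finset.Icc 1 J, loopQ p i j * δ i (δ j σ) * t := by
    have e1 : ∑ j ∈ Finset.Icc 1 J, (δ j σ * t) * loopP ε p j
        = (∑ j ∈ Finset.Icc 1 J, loopP ε p j * δ j σ) * t := by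
      rw [Finset.sum_mul]
      exact Finset.sum_congr rfl fun j _ => by ring
    have e2 : ∑ i ∈ Finset.Icc 1 J, ∑ j ∈ Finset.Icc 1 J, loopQ p i j * δ i (δ j σ) * t
        = (∑ i ∈ Finset.Icc 1 J, ∑ j ∈ Finset.Icc 1 J, loopQ p i j * δ i (δ j σ)) * t := by
      rw [Finset.sum_mul]
      exact Finset.sum_congr rfl fun j _ => by rw [Finset.sum_mul]
    rw [e1, e2]
    push_cast
    linear_combination t * h1
  have h3 := congrArg E h2
  rw [map_intCast_mul, map_sub, map_sum, Finset.sum_comm, map_sum, ← Finset.sum_sub_distrib] at h3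
  push_cast at h3
  rw [h3]
  refine Finset.sum_congr rfl fun j hj => ?_
  have hj1 : 1 ≤ j := (Finset.mem_Icc.mp hj).1
  rw [hE.map_loopP _ J j hj1, map_sum, ← Finset.sum_sub_distrib]
  · refine Finset.sum_congr rfl fun i _ => ?_
    rw [← map_sub, hE.isDer i, loopQ_comm p j i]
    congr 1
    ring
  · intro i hi
    rw [hE.isDer i, ht i hi, hE.der_der_hook_eq_zero hj1 (by omega)]
    simp

lemma map_hook_of_lt {α β : ℕ} (hβ : β < M) : E (hook ε p α β) = 0 := by
  have h := hE.eigen_mul (α := α) (β := β) le_rfl (t := 1) fun i _ => (hE.isDer i).map_one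
  rw [Finset.sum_eq_zero fun j _ => Finset.sum_eq_zero fun i _ => by
    rw [(hE.isDer i).map_one, mul_zero, map_zero], mul_one] at h
  have h1 : (β : ℝ) + 1 ≤ M := by exact_mod_cast hβ
  have h2 : 0 < ((α : ℝ) + β + 1) * (M + α - β) := by
    apply mul_pos
    · positivity
    · have : (0 : ℝ) ≤ α := by positivity
      linarith
  exact (mul_eq_zero.mp h).resolve_left h2.ne'

lemma map_hook (α β : ℕ) :
    E (hook ε p α β) = if α + M = β then E (hook ε p 0 M) else 0 := by
  rcases lt_or_ge β M with h | h
  · rw [hE.map_hook_of_lt h, if_neg (by omega)]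
  · simpa using hE.map_hook_mul α β 1 h

lemma map_apply (j : ℕ) : E (p j) = (ε : ℝ) * (if j % 2 = 0 then 1 else 0)
    + (if j = 0 then (M : ℝ) else 0)
    + E (hook ε p 0 M) * (if M + 1 ≤ j ∧ (j + M + 1) % 2 = 0 then 1 else 0) := by
  cases j with
  | zero =>
    have h : p 0 = (((M : ℤ) + ε : ℤ) : B) * 1 := by rw [hE.apply_zero]; push_cast; ring
    rw [h, map_intCast_mul, hE.map_one]
    simp
    ring
  | succ k =>
    have h := congrArg E (sum_hook hE.sign p k)
    rw [map_sum, Finset.sum_congr rfl fun ij _ => hE.map_hook ij.1 ij.2,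
      sum_antidiagonal_ite_add, map_sub, map_intCast_mul] at h
    have h1 : E (if Even (k + 1) then 1 else 0) = if (k + 1) % 2 = 0 then 1 else 0 := by
      simp only [Nat.even_iff]
      split_ifs
      · exact hE.map_one
      · exact map_zero _
    rw [h1] at h
    have h2 : (if M ≤ k ∧ (k + M) % 2 = 0 then E (hook ε p 0 M) else 0)
      = E (hook ε p 0 M) * (if M + 1 ≤ k + 1 ∧ (k + 1 + M + 1) % 2 = 0 then 1 else 0) := by
      rw [mul_ite, mul_one, mul_zero]
      congr 1
      rw [eq_iff_iff]
      omega
    rw [h2] at h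
    rw [if_neg (Nat.succ_ne_zero k)]
    linear_combination -h

/-- The moment of a hook against a power sum. -/
lemma map_hook_mul_apply (m : ℕ) : ∀ (α β : ℕ), β < M →
    E (hook ε p α β * p m) = (if m = α + β + 1 then 1 else 0)
      - E (hook ε p 0 M) * (if m = α + M - β then 1 else 0) := by
  suffices H : ∀ (s m α β : ℕ), α + β = s → β < M →
    E (hook ε p α β * p m) = (if m = α + β + 1 then 1 else 0)
      - E (hook ε p 0 M) * (if m = α + M - β then 1 else 0) from fun α β => H _ m α β rfl
  intro s
  induction s using Nat.strong_induction_on with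
  | _ s ih =>
  intro m α β hs hβ
  rcases Nat.eq_zero_or_pos m with rfl | hm
  · have h : p 0 = (((M : ℤ) + ε : ℤ) : B) := by rw [hE.apply_zero]; push_cast; ring
    rw [h, mul_comm, map_intCast_mul, hE.map_hook_of_lt hβ, if_neg (by omega), if_neg (by omega)]
    simp
  set κ := E (hook ε p 0 M) with hκ
  set J := m + (α + β + 1) with hJ
  have h1 := hE.eigen_mul (α := α) (β := β) (J := J) (by omega) (t := p m) (fun i hi => by
    rw [hE.der_apply i (by omega), if_neg (by omega)])
  have h2 : ∀ j ∈ Finset.Icc 1 J, ∑ i ∈ Finset.Icc 1 J,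
      E (loopQ p i j * δ j (hook ε p α β) * δ i (p m))
      = m * E (loopQ p m j * δ j (hook ε p α β)) := by
    intro j _
    rw [Finset.sum_eq_single m]
    · rw [hE.der_apply m hm, if_pos rfl, mul_comm]
      exact_mod_cast map_intCast_mul E m _
    · intro i hi him
      rw [hE.der_apply i (Finset.mem_Icc.mp hi).1, if_neg him.symm, mul_zero, map_zero]
    · intro h
      simp only [Finset.mem_Icc] at h
      omega
  have h3 : ∀ j ∈ Finset.Icc 1 J, E (loopQ p m j * δ j (hook ε p α β))
      = (if j ≤ α then E (loopQ p m j * hook ε p (α - j) β) else 0)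
        - (if j ≤ β then E (loopQ p m j * hook ε p α (β - j)) else 0)
        + if j = α + β + 1 then E (loopQ p m j) else 0 := by
    intro j hj
    have hj1 : 1 ≤ j := (Finset.mem_Icc.mp hj).1
    rw [der_hook (hE.isDer j) hj1 (hE.der_apply j hj1) hE.sign, mul_add, mul_sub, map_add,
      map_sub]
    split_ifs <;> simp
  have hQ : ∀ j f, E (loopQ p m j * f) = E (f * p ((m - j) + (j - m))) - E (f * p (m + j)) := by
    intro j f
    rw [loopQ, ← map_sub]
    congr 1
    ring
  have hα : ∀ j ∈ Finset.Icc 1 α, E (loopQ p m j * hook ε p (α - j) β)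
      = (((if (m - j) + (j - m) + j = α + β + 1 then (1 : ℤ) else 0)
        - if m + j + j = α + β + 1 then 1 else 0 : ℤ) : ℝ)
        - κ * (((if (m - j) + (j - m) + j = α + M - β then (1 : ℤ) else 0)
        - if m + j + j = α + M - β then 1 else 0 : ℤ) : ℝ) := by
    intro j hj
    simp only [Finset.mem_Icc] at hj
    rw [hQ, ih (α - j + β) (by omega) _ _ _ rfl hβ, ih (α - j + β) (by omega) _ _ _ rfl hβ]
    simp only [show ((m - j) + (j - m) = α - j + β + 1) ↔
        ((m - j) + (j - m) + j = α + β + 1) by omega,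
      show (m + j = α - j + β + 1) ↔
        (m + j + j = α + β + 1) by omega,
      show ((m - j) + (j - m) = α - j + M - β) ↔
        ((m - j) + (j - m) + j = α + M - β) by omega,
      show (m + j = α - j + M - β) ↔
        (m + j + j = α + M - β) by omega]
    push_cast
    ring
  have hβ' : ∀ j ∈ Finset.Icc 1 β, E (loopQ p m j * hook ε p α (β - j))
      = (((if (m - j) + (j - m) + j = α + β + 1 then (1 : ℤ) else 0)
        - if m + j + j = α + β + 1 then 1 else 0 : ℤ) : ℝ)
        - κ * (((if (m - j) + (j - m) = (α + M - β) + j then (1 : ℤ) else 0)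
        - if m + j = (α + M - β) + j then 1 else 0 : ℤ) : ℝ) := by
    intro j hj
    simp only [Finset.mem_Icc] at hj
    rw [hQ, ih (α + (β - j)) (by omega) _ _ _ rfl (by omega),
      ih (α + (β - j)) (by omega) _ _ _ rfl (by omega)]
    simp only [show ((m - j) + (j - m) = α + (β - j) + 1) ↔
        ((m - j) + (j - m) + j = α + β + 1) by omega,
      show (m + j = α + (β - j) + 1) ↔
        (m + j + j = α + β + 1) by omega,
      show ((m - j) + (j - m) = α + M - (β - j)) ↔
        ((m - j) + (j - m) = (α + M - β) + j) by omega,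
      show (m + j = α + M - (β - j)) ↔
        (m + j = (α + M - β) + j) by omega]
    push_cast
    ring
  have h4 : E (loopQ p m (α + β + 1)) = (((if m = α + β + 1 then (M : ℤ) else 0) : ℤ) : ℝ)
      + κ * (((if M + 1 ≤ (m - (α + β + 1)) + (α + β + 1 - m)
            ∧ ((m - (α + β + 1)) + (α + β + 1 - m) + M + 1) % 2 = 0 then 1 else 0)
        - if M + 1 ≤ m + (α + β + 1) ∧ (m + (α + β + 1) + M + 1) % 2 = 0 then 1 else 0 : ℤ)
        : ℝ) := by
    rw [loopQ, map_sub, hE.map_apply, hE.map_apply, if_neg (show ¬ m + (α + β + 1) = 0 by omega)]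
    simp only [show (m - (α + β + 1) + (α + β + 1 - m)) % 2 = 0 ↔ (m + (α + β + 1)) % 2 = 0 by
        omega, show m - (α + β + 1) + (α + β + 1 - m) = 0 ↔ m = α + β + 1 by omega]
    push_cast
    ring
  rw [Finset.sum_congr rfl h2, ← Finset.mul_sum, Finset.sum_congr rfl h3,
    Finset.sum_add_distrib, Finset.sum_sub_distrib, sum_Icc_ite_le (by omega),
    sum_Icc_ite_le (by omega), Finset.sum_ite_eq', if_pos (by simp [hJ]), h4,
    Finset.sum_congr rfl hα, Finset.sum_congr rfl hβ', Finset.sum_sub_distrib,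
    Finset.sum_sub_distrib, ← Finset.mul_sum, ← Finset.mul_sum] at h1
  have i0 := congrArg (Int.cast : ℤ → ℝ) (moment_identity_zero α β m M hm)
  have i1 := congrArg (Int.cast : ℤ → ℝ) (moment_identity_one α β m M hm hβ)
  simp only [Int.cast_add, Int.cast_sub, Int.cast_sum, Int.cast_neg] at i0 i1 h1
  have hb : (β : ℝ) + 1 ≤ M := by exact_mod_cast hβ
  have hpos : 0 < ((α : ℝ) + β + 1) * (M + α - β) := by
    apply mul_pos
    · positivity
    · have : (0 : ℝ) ≤ α := by positivity
      linarith
  refine mul_left_cancel₀ hpos.ne' (h1.trans ?_)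
  have e0 : (m : ℝ) * (((if m = α + β + 1 then (α + M - β : ℤ) else 0) : ℤ) : ℝ)
      = ((α : ℝ) + β + 1) * (M + α - β) * (if m = α + β + 1 then 1 else 0) := by
    split_ifs with h
    · rw [h]; push_cast; ring
    · simp
  have e1 : (m : ℝ) * (((if m = α + M - β then (α + β + 1 : ℤ) else 0) : ℤ) : ℝ)
      = ((α : ℝ) + β + 1) * (M + α - β) * (if m = α + M - β then 1 else 0) := by
    split_ifs with h
    · rw [h, Nat.cast_sub (by omega)]; push_cast; ring
    · simp
  linear_combination (m : ℝ) * i0 + (m : ℝ) * κ * i1 + e0 - κ * e1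

omit [IsDomain B] [CharZero B] in
lemma abs_map_hook_mul_le (f : B) :
    |E (hook ε p 0 M * f)| ≤ 1 / 2 + E (f * f) / 2 := by
  have h1 := hE.map_mul_self_nonneg (hook ε p 0 M + f)
  have h2 := hE.map_mul_self_nonneg (hook ε p 0 M - f)
  have e1 : (hook ε p 0 M + f) * (hook ε p 0 M + f) = hook ε p 0 M * hook ε p 0 M
    + hook ε p 0 M * f + hook ε p 0 M * f + f * f := by ring
  have e2 : (hook ε p 0 M - f) * (hook ε p 0 M - f) = hook ε p 0 M * hook ε p 0 M
    - hook ε p 0 M * f - hook ε p 0 M * f + f * f := by ring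
  rw [e1, map_add, map_add, map_add] at h1
  rw [e2, map_add, map_sub, map_sub] at h2
  have := hE.map_hook_mul_self
  rw [abs_le]
  constructor <;> linarith

omit [IsDomain B] [CharZero B] in
lemma abs_map_hook_zero_le : |E (hook ε p 0 M)| ≤ 1 := by
  have h := hE.abs_map_hook_mul_le 1
  rw [mul_one, mul_one, hE.map_one] at h
  linarith

/-- The second moment of a power sum grows at most linearly. -/
theorem map_apply_mul_self_le {k : ℕ} (hk : 1 ≤ k) : E (p k * p k) ≤ 9 * k := by
  obtain ⟨K, rfl⟩ : ∃ K, k = K + 1 := ⟨k - 1, by omega⟩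
  set q := p (K + 1) with hq
  set X := E (q * q) with hX
  have hX0 : 0 ≤ X := hE.map_mul_self_nonneg q
  have hκ := abs_le.mp hE.abs_map_hook_zero_le
  have hD := hE.abs_map_hook_mul_le q
  have hD' := le_trans (le_abs_self _) hD
  have hqq : q * q = ∑ ij ∈ Finset.HasAntidiagonal.antidiagonal K, hook ε p ij.1 ij.2 * q
      + (ε : B) * if Even (K + 1) then q else 0 := by
    rw [← Finset.sum_mul, sum_hook hE.sign p K, ← hq]
    split_ifs <;> ring
  have h1 := congrArg E hqq
  rw [map_add, map_sum, map_intCast_mul] at h1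
  have hterm : ∀ ij ∈ Finset.HasAntidiagonal.antidiagonal K, E (hook ε p ij.1 ij.2 * q)
      ≤ 2 + if ij.1 + M = ij.2 then 1 / 2 + X / 2 else 0 := by
    rintro ⟨α, β⟩ -
    rcases lt_or_ge β M with h | h
    · rw [if_neg (by simp only; omega), hE.map_hook_mul_apply _ _ _ h]
      split_ifs <;> linarith
    · rw [hE.map_hook_mul _ _ _ h]
      split_ifs <;> linarith
  have h2 := Finset.sum_le_sum hterm
  rw [Finset.sum_add_distrib, sum_antidiagonal_ite_add, Finset.sum_const,
    Finset.Nat.card_antidiagonal, nsmul_eq_mul] at h2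
  have h3 : (if M ≤ K ∧ (K + M) % 2 = 0 then 1 / 2 + X / 2 else 0) ≤ 1 / 2 + X / 2 := by
    split_ifs <;> linarith
  have hEq : |E q| ≤ 2 := by
    rw [hq, hE.map_apply, if_neg (Nat.succ_ne_zero K), abs_le]
    rcases hE.sign with rfl | rfl <;> split_ifs <;> push_cast <;> constructor <;> linarith
  have h4 : (ε : ℝ) * E (if Even (K + 1) then q else 0) ≤ 2 := by
    have := abs_le.mp hEq
    split_ifs
    · rcases hE.sign with rfl | rfl <;> push_cast <;> linarith
    · simp
  have hK : (0 : ℝ) ≤ K := by positivity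
  push_cast at h2 ⊢
  linarith

end IsLoopFunctional
end LoopFunctional

section

open PowerSeries

section MatrixNewton

variable {ι : Type*} [Fintype ι] [DecidableEq ι]

/-- The matrix `(1 - z U)⁻¹` of power series. -/
def resolventSeries {K : Type*} [CommRing K] (U : Matrix ι ι K) : Matrix ι ι (PowerSeries K) :=
  Matrix.of fun i j => PowerSeries.mk fun k => (U ^ k) i j

variable {K : Type*} [Field K]

lemma one_sub_mul_resolventSeries (U : Matrix ι ι K) :
    (1 - (X : PowerSeries K) • U.map C) * resolventSeries U = 1 := by
  rw [sub_mul, one_mul, sub_eq_iff_eq_add]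
  ext i j k
  rw [Matrix.add_apply, smul_mul_assoc, Matrix.smul_apply, smul_eq_mul, map_add]
  cases k with
  | zero =>
    simp [resolventSeries, Matrix.one_apply]
  | succ k =>
    have h1 : coeff (k + 1) ((1 : Matrix ι ι (PowerSeries K)) i j) = 0 := by
      rw [Matrix.one_apply]
      split_ifs <;> simp [coeff_one]
    rw [h1, coeff_succ_X_mul, zero_add, Matrix.mul_apply, map_sum]
    simp [resolventSeries, pow_succ', Matrix.mul_apply]

lemma trace_resolventSeries_mul (U : Matrix ι ι K) :
    X * trace (resolventSeries U * U.map C) = powerSumSeries fun k => trace (U ^ k) := by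
  ext k
  cases k with
  | zero => simp
  | succ k =>
    rw [coeff_succ_X_mul, coeff_powerSumSeries, if_neg (Nat.succ_ne_zero k), trace, map_sum, trace]
    refine Finset.sum_congr rfl fun i _ => ?_
    rw [Matrix.diag_apply, Matrix.diag_apply, Matrix.mul_apply, map_sum, pow_succ,
      Matrix.mul_apply]
    simp [resolventSeries]

lemma derivative_charpolyRev (U : Matrix ι ι K) :
    ((Polynomial.derivative U.charpolyRev : Polynomial K) : PowerSeries K)
      = -((U.charpolyRev : PowerSeries K) * trace (resolventSeries U * U.map C)) := by
  set F := U.charpolyRev with hF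
  set G := resolventSeries U * U.map C with hG
  set N : Matrix ι ι (PowerSeries K) := 1 - (X : PowerSeries K) • U.map C with hN
  set φ : Polynomial K →+* Polynomial (PowerSeries K) :=
    Polynomial.eval₂RingHom (Polynomial.C.comp (C (R := K)))
      (Polynomial.X + Polynomial.C (X : PowerSeries K)) with hφ
  have hdetN : (F : PowerSeries K) = N.det := by
    rw [hF, Matrix.charpolyRev, hN, ← Polynomial.coeToPowerSeries.ringHom_apply, RingHom.map_det]
    congr 1
    ext1 i j
    by_cases hij : i = j <;> simp [hij] <;> exact mul_comm _ _
  have h1 : φ F = (N.map Polynomial.C).det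
      * (1 + (Polynomial.X : Polynomial (PowerSeries K)) • (-G).map Polynomial.C).det := by
    rw [hF, Matrix.charpolyRev, RingHom.map_det, ← det_mul]
    congr 1
    have h2 : N.map Polynomial.C * G.map Polynomial.C = (U.map C).map Polynomial.C := by
      rw [← Matrix.map_mul, hG, ← mul_assoc, hN, one_sub_mul_resolventSeries, one_mul]
    have h3 : ((-G).map Polynomial.C : Matrix ι ι (Polynomial (PowerSeries K)))
        = -(G.map Polynomial.C) := by ext1; simp
    rw [mul_add, mul_one, mul_smul_comm, h3, mul_neg, h2, hN]
    ext1 i j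
    by_cases hij : i = j <;> simp [hij, hφ] <;> ring
  have h4 : φ F = (F.map C).comp (Polynomial.X + Polynomial.C (X : PowerSeries K)) := by
    rw [hφ, Polynomial.comp, Polynomial.eval₂_map]
    rfl
  have h5 := congrArg (fun q => (Polynomial.derivative q).eval 0) h1
  simp only [h4, Polynomial.derivative_comp] at h5
  have h6 : (N.map Polynomial.C).det = Polynomial.C N.det := by
    rw [← RingHom.mapMatrix_apply, ← RingHom.map_det]
  rw [h6, Polynomial.derivative_C_mul, Polynomial.eval_mul, Polynomial.eval_mul,
    Polynomial.eval_C, derivative_det_one_add_X_smul, trace_neg, mul_neg, ← hdetN,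
    Polynomial.eval_comp, Polynomial.derivative_map] at h5
  rw [← h5]
  simp [Polynomial.eval_map, Polynomial.eval₂_C_X_eq_coe]

lemma euler_charpolyRev (U : Matrix ι ι K) :
    euler K (U.charpolyRev : PowerSeries K)
      = ((-1 : ℤ) * powerSumSeries fun k => trace (U ^ k)) * U.charpolyRev := by
  have h : euler K (U.charpolyRev : PowerSeries K)
      = X * ((Polynomial.derivative U.charpolyRev : Polynomial K) : PowerSeries K) := by
    ext k
    cases k with
    | zero => simp
    | succ k => simp [coeff_succ_X_mul, Polynomial.coeff_derivative]; ring
  rw [h, derivative_charpolyRev, ← trace_resolventSeries_mul]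
  push_cast
  ring

/-- Newton's identities for the characteristic polynomial of a matrix. -/
lemma newton_trace_pow [CharZero K] (U : Matrix ι ι K) (k : ℕ) :
    newton (-1) (fun k => trace (U ^ k)) k = U.charpolyRev.coeff k := by
  have h : newtonSeries (-1) (fun k => trace (U ^ k)) = (U.charpolyRev : PowerSeries K) := by
    refine eq_of_euler_eq_mul (euler_newtonSeries _ _) (euler_charpolyRev U) (by simp) ?_
    rw [coeff_newtonSeries, newton_zero, Polynomial.coeff_coe, Polynomial.coeff_zero_eq_eval_zero,
      eval_charpolyRev]
  have := congrArg (coeff k) h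
  simpa using this

lemma charpolyRev_coeff_eq_zero (U : Matrix ι ι K) {k : ℕ} (hk : Fintype.card ι < k) :
    U.charpolyRev.coeff k = 0 := by
  rw [← reverse_charpoly]
  refine Polynomial.coeff_eq_zero_of_natDegree_lt ((Polynomial.reverse_natDegree_le _).trans_lt ?_)
  rwa [charpoly_natDegree_eq_dim]

lemma charpolyRev_coeff_sub (U : Matrix ι ι K) (hU : IsUnit U) (h : U⁻¹.charpoly = U.charpoly) :
    ∃ s : K, ∀ k ≤ Fintype.card ι,
      U.charpolyRev.coeff (Fintype.card ι - k) = s * U.charpolyRev.coeff k := by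
  refine ⟨(-1) ^ Fintype.card ι * Ring.inverse U.det, fun k hk => ?_⟩
  have h1 := charpoly_inv U hU
  rw [h] at h1
  have h2 := congrArg (fun q => Polynomial.coeff q k) h1
  have h3 : ((-1) ^ Fintype.card ι * Polynomial.C (Ring.inverse U.det) * U.charpolyRev).coeff k
    = (-1) ^ Fintype.card ι * Ring.inverse U.det * U.charpolyRev.coeff k := by
    rw [show ((-1) ^ Fintype.card ι * Polynomial.C (Ring.inverse U.det) : Polynomial K)
      = Polynomial.C ((-1) ^ Fintype.card ι * Ring.inverse U.det) by simp, Polynomial.coeff_C_mul]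
  rw [h3] at h2
  rw [← h2, ← reverse_charpoly, Polynomial.coeff_reverse, charpoly_natDegree_eq_dim,
    Polynomial.revAt_le (by omega), Nat.sub_sub_self hk]

end MatrixNewton

section HookEval

section Map

variable {B B' : Type*} [CommRing B] [CommRing B'] [Algebra ℚ B] [Algebra ℚ B']
  (φ : B →+* B')

lemma map_newton (c : ℤ) (p : ℕ → B) (k : ℕ) :
    φ (newton c p k) = newton c (fun j => φ (p j)) k := by
  induction k using Nat.strong_induction_on with
  | _ k ih =>
    cases k with
    | zero => simp
    | succ k =>
      rw [newton, newton, map_rat_smul, map_mul, map_intCast, map_sum]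
      congr 2
      refine Finset.sum_congr rfl fun i _ => ?_
      rw [map_mul, ih i (by omega)]

lemma map_newtonSeries (c : ℤ) (p : ℕ → B) :
    PowerSeries.map φ (newtonSeries c p) = newtonSeries c fun j => φ (p j) := by
  ext k
  simp [map_newton]

lemma map_hook (ε : ℤ) (p : ℕ → B) (α β : ℕ) :
    φ (hook ε p α β) = hook ε (fun j => φ (p j)) α β := by
  set Φ := PowerSeries.map (PowerSeries.map φ)
  have hX : Φ (serX B) = serX B' := by simp [Φ, serX]
  have hZ : Φ (serZ B) = serZ B' := by simp [Φ, serZ]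
  have hU : Φ (serU B) = serU B' := by ext k : 1; simp [Φ, serU]
  have hW : Φ (serW B ε) = serW B' ε := by
    rw [serW, serW]
    split_ifs <;> simp [hX, hZ]
  have hT : Φ (serT p) = serT fun j => φ (p j) := by
    ext j i
    simp [Φ, serT, map_newton]
  have hH : Φ (serH p) = serH fun j => φ (p j) := by
    simp [Φ, serH, map_newtonSeries]
  have h : Φ (hookSeries ε p) = hookSeries ε fun j => φ (p j) := by
    rw [hookSeries, hookSeries, map_mul, map_neg, map_add, map_mul, map_mul, hU, hW, hT, hH]
    congr 3
    split_ifs <;> simp [hX, hZ]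
  rw [hook, hook, ← h, coeff₂, coeff₂, PowerSeries.coeff_map, PowerSeries.coeff_map]

end Map

variable {K : Type*} [Field K] [CharZero K] {p : ℕ → K} {d : ℕ} {s : K}

/-- The generating series of `newton (-1) p` divided by `1 - x z`, beyond the degree. -/
lemma coeff_serH_mul_serE_mul_serU [Algebra ℚ K] (h0 : ∀ k, d < k → newton (-1) p k = 0)
    (hs : ∀ k ≤ d, newton (-1) p (d - k) = s * newton (-1) p k) (a b : ℕ) (hb : d ≤ b) :
    coeff₂ a b (serH p * serE p * serU K) = if a + d = b then s else 0 := by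
  have h1 : coeff b (serE p * serU K) = C s * (X ^ (b - d) * newtonSeries (-1) p) := by
    ext a
    rw [coeff_mul, map_sum, coeff_C_mul, coeff_X_pow_mul']
    simp only [serE, serU, coeff_map, coeff_mk, coeff_newtonSeries, coeff_C_mul, coeff_X_pow]
    rw [Finset.Nat.sum_antidiagonal_eq_sum_range_succ_mk]
    simp only [mul_ite, mul_one, mul_zero]
    split_ifs with h
    · rw [Finset.sum_ite, Finset.sum_const_zero, add_zero]
      by_cases h' : a ≤ b
      · rw [Finset.sum_eq_single (b - a)]
        · rw [← hs (a - (b - d)) (by omega)]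
          congr 1
          omega
        · intro i hi hne
          simp only [Finset.mem_filter, Finset.mem_range] at hi
          omega
        · intro h''
          simp only [Finset.mem_filter, Finset.mem_range] at h''
          omega
      · rw [Finset.sum_eq_zero, h0 _ (by omega), mul_zero]
        intro i hi
        simp only [Finset.mem_filter, Finset.mem_range] at hi
        omega
    · refine Finset.sum_eq_zero fun i hi => ?_
      split_ifs with h'
      · simp only [Finset.mem_range] at hi
        exact h0 i (by omega)
      · rfl
  rw [coeff₂, mul_assoc, serH, coeff_C_mul, h1, show newtonSeries 1 p *
    (C s * (X ^ (b - d) * newtonSeries (-1) p))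
    = C s * (X ^ (b - d) * (newtonSeries 1 p * newtonSeries (-1) p)) by ring,
    newtonSeries_mul_newtonSeries, mul_one, coeff_C_mul, coeff_X_pow, mul_ite, mul_one, mul_zero]
  congr 1
  rw [eq_iff_iff]
  omega

/-- Hooks with a long leg evaluate to `0` or to a common sign. -/
lemma hook_of_le [Algebra ℚ K] {ε : ℤ} (hε : ε = 1 ∨ ε = -1) {M : ℕ} (hM : (M : ℤ) + ε = d)
    (h0 : ∀ k, d < k → newton (-1) p k = 0)
    (hs : ∀ k ≤ d, newton (-1) p (d - k) = s * newton (-1) p k) (α β : ℕ) (hβ : M ≤ β) :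
    hook ε p α β = if α + M = β then -(ε * s) else 0 := by
  have hG : ∀ a b, M + 1 ≤ b → coeff₂ a b (serG ε p)
      = (if a + M = b + 1 then -(ε * s) else 0) - if a + M + 1 = b then -(ε * s) else 0 := by
    intro a b hb
    have e : serG ε p = serW K ε * (serH p * serE p * serU K) := by rw [serG]; ring
    have H := coeff_serH_mul_serE_mul_serU h0 hs
    rw [e, serW]
    rcases hε with rfl | rfl
    · rw [if_pos rfl, sub_mul, one_mul, coeff₂_sub, coeff₂_serX_pow_mul, H _ _ (by omega),
        H _ _ (by omega)]
      split_ifs <;> first | omega | (push_cast; ring)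
    · rw [if_neg (by decide), sub_mul, one_mul, coeff₂_sub, coeff₂_serZ_pow_mul,
        H _ _ (by omega), H _ _ (by omega)]
      split_ifs <;> first | omega | (push_cast; ring)
  induction α generalizing β with
  | zero =>
    have h := hG 0 (β + 1) (by omega)
    rw [coeff₂_serG hε, if_neg (by omega), if_pos (by omega), if_neg (by omega),
      add_tsub_cancel_right] at h
    split_ifs at h ⊢ <;> first | omega | linear_combination -h
  | succ α ih =>
    have h := hG (α + 1) (β + 1) (by omega)
    rw [coeff₂_serG hε, if_pos (by omega), if_pos (by omega), if_neg (by omega),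
      add_tsub_cancel_right, add_tsub_cancel_right, ih (β + 1) (by omega)] at h
    split_ifs at h ⊢ <;> first | omega | linear_combination -h

omit [CharZero K] in
lemma sq_eq_one_of_palindrome [Algebra ℚ K]
    (hs : ∀ k ≤ d, newton (-1) p (d - k) = s * newton (-1) p k) : s ^ 2 = 1 := by
  have h1 := hs 0 (Nat.zero_le d)
  have h2 := hs d le_rfl
  rw [Nat.sub_self, newton_zero] at h2
  rw [Nat.sub_zero, newton_zero] at h1
  rw [h1] at h2
  linear_combination -h2

end HookEval

end

section FormGroup

variable {ι : Type*} [Fintype ι] [DecidableEq ι]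

/-- The unitary matrices preserving the bilinear form with matrix `S`. -/
def formGroup (S : Matrix ι ι ℂ) : Set (Matrix ι ι ℂ) :=
  {U | U ∈ Matrix.unitaryGroup ι ℂ ∧ U * S * Uᵀ = S ∧ Uᵀ * S * U = S}

/-- `S` is a real orthogonal matrix that is symmetric (`ε = 1`) or skew-symmetric (`ε = -1`). -/
structure IsForm (ε : ℤ) (S : Matrix ι ι ℂ) : Prop where
  sign : ε = 1 ∨ ε = -1
  transpose_eq : Sᵀ = (ε : ℂ) • S
  conjTranspose_eq : Sᴴ = Sᵀ
  mul_transpose : S * Sᵀ = 1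

namespace IsForm

variable {ε : ℤ} {S U : Matrix ι ι ℂ}

lemma transpose_mul (hS : IsForm ε S) : Sᵀ * S = 1 := mul_eq_one_comm.mp hS.mul_transpose

lemma transpose_mul_transpose (hS : IsForm ε S) : Sᵀ * Sᵀ = (ε : ℂ) • 1 := by
  nth_rw 1 [hS.transpose_eq]
  rw [smul_mul_assoc, hS.mul_transpose]

lemma sign_mul_sign (hS : IsForm ε S) : (ε : ℂ) * ε = 1 := by
  rcases hS.sign with h | h <;> simp [h]

lemma mul_self (hS : IsForm ε S) : S * S = (ε : ℂ) • 1 := by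
  have := congrArg transpose hS.transpose_mul_transpose
  rwa [Matrix.transpose_mul, transpose_transpose, transpose_smul, transpose_one] at this

lemma conjTranspose_mul_self (hU : U ∈ formGroup S) : Uᴴ * U = 1 := by
  have := (Unitary.mem_iff.mp hU.1).1
  rwa [star_eq_conjTranspose] at this

lemma mul_conjTranspose_self (hU : U ∈ formGroup S) : U * Uᴴ = 1 :=
  mul_eq_one_comm.mp (conjTranspose_mul_self hU)

lemma conjTranspose_eq_conj (hS : IsForm ε S) (hU : U ∈ formGroup S) : Uᴴ = S * Uᵀ * Sᵀ := by
  have h : Uᴴ * (U * S * Uᵀ) = Uᴴ * S := by rw [hU.2.1]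
  rw [mul_assoc, ← mul_assoc, conjTranspose_mul_self hU, one_mul] at h
  rw [h, mul_assoc, hS.mul_transpose, mul_one]

lemma conjTranspose_pow_eq (hS : IsForm ε S) (hU : U ∈ formGroup S) (j : ℕ) :
    Uᴴ ^ j = S * Uᵀ ^ j * Sᵀ := by
  induction j with
  | zero => rw [pow_zero, pow_zero, mul_one, hS.mul_transpose]
  | succ j ih =>
    rw [pow_succ, ih, hS.conjTranspose_eq_conj hU, pow_succ]
    calc S * Uᵀ ^ j * Sᵀ * (S * Uᵀ * Sᵀ) = S * Uᵀ ^ j * (Sᵀ * S) * Uᵀ * Sᵀ := by noncomm_ring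
      _ = S * (Uᵀ ^ j * Uᵀ) * Sᵀ := by rw [hS.transpose_mul, mul_one, mul_assoc S]

lemma trace_conjTranspose_pow (hS : IsForm ε S) (hU : U ∈ formGroup S) (j : ℕ) :
    trace (Uᴴ ^ j) = trace (U ^ j) := by
  rw [hS.conjTranspose_pow_eq hU, mul_assoc, trace_mul_comm, mul_assoc, hS.transpose_mul, mul_one,
    ← transpose_pow, trace_transpose]

lemma ofReal_re_trace (hS : IsForm ε S) (hU : U ∈ formGroup S) (j : ℕ) :
    ((trace (U ^ j)).re : ℂ) = trace (U ^ j) := by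
  rw [← Complex.conj_eq_iff_re, starRingEnd_apply, ← trace_conjTranspose,
    conjTranspose_pow, hS.trace_conjTranspose_pow hU]

lemma charpoly_inv_eq (hS : IsForm ε S) (hU : U ∈ formGroup S) : U⁻¹.charpoly = U.charpoly := by
  rw [inv_eq_right_inv (mul_conjTranspose_self hU), hS.conjTranspose_eq_conj hU, mul_assoc,
    charpoly_mul_comm, mul_assoc, hS.transpose_mul, mul_one, charpoly_transpose]

lemma ofReal_newton (hS : IsForm ε S) (hU : U ∈ formGroup S) (k : ℕ) :
    ((newton (-1) (fun j => (trace (U ^ j)).re) k : ℝ) : ℂ) = U.charpolyRev.coeff k := by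
  rw [← newton_trace_pow, ← Complex.ofRealHom_eq_coe, map_newton]
  congr 1
  funext j
  exact hS.ofReal_re_trace hU j

lemma newton_eq_zero (hS : IsForm ε S) (hU : U ∈ formGroup S) {k : ℕ} (hk : Fintype.card ι < k) :
    newton (-1) (fun j => (trace (U ^ j)).re) k = 0 := by
  have := hS.ofReal_newton hU k
  rw [charpolyRev_coeff_eq_zero U hk] at this
  exact_mod_cast this

lemma exists_newton_sub (hS : IsForm ε S) (hU : U ∈ formGroup S) :
    ∃ s : ℝ, ∀ k ≤ Fintype.card ι, newton (-1) (fun j => (trace (U ^ j)).re) (Fintype.card ι - k)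
      = s * newton (-1) (fun j => (trace (U ^ j)).re) k := by
  have hunit : IsUnit U := IsUnit.of_mul_eq_one _ (mul_conjTranspose_self hU)
  obtain ⟨s, hs⟩ := charpolyRev_coeff_sub U hunit (hS.charpoly_inv_eq hU)
  have h0 := hs 0 (Nat.zero_le _)
  rw [← newton_trace_pow U 0, newton_zero, mul_one, Nat.sub_zero, ← hS.ofReal_newton hU] at h0
  refine ⟨newton (-1) (fun j => (trace (U ^ j)).re) (Fintype.card ι), fun k hk => ?_⟩
  have := hs k hk
  rw [← hS.ofReal_newton hU, ← hS.ofReal_newton hU, ← h0] at this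
  exact_mod_cast this

/-- On the group of a form, hooks with a long leg evaluate to `0` or to a common sign. -/
lemma exists_hook_eq (hS : IsForm ε S) (hU : U ∈ formGroup S) {M : ℕ}
    (hM : (M : ℤ) + ε = Fintype.card ι) :
    ∃ c : ℝ, c ^ 2 = 1 ∧ ∀ α β, M ≤ β → hook ε (fun j => (trace (U ^ j)).re) α β
      = if α + M = β then c else 0 := by
  obtain ⟨s, hs⟩ := hS.exists_newton_sub hU
  refine ⟨-(ε * s), ?_, fun α β hβ =>
    hook_of_le hS.sign hM (fun k hk => hS.newton_eq_zero hU hk) hs α β hβ⟩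
  have := sq_eq_one_of_palindrome hs
  rcases hS.sign with h | h <;> simp [h, this]

end IsForm

end FormGroup

section Haar

variable {ι : Type*} [Fintype ι] [DecidableEq ι]

instance borelSpace_matrix {m n R : Type*} [Finite m] [Finite n] [TopologicalSpace R]
    [SecondCountableTopology R] [MeasurableSpace R] [BorelSpace R] : BorelSpace (Matrix m n R) :=
  haveI := Fintype.ofFinite m
  haveI := Fintype.ofFinite n
  inferInstanceAs (BorelSpace (m → n → R))

/-- `μ` is a left-invariant probability measure on the group of the form `S`. -/
structure IsFormHaar (S : Matrix ι ι ℂ) (μ : Measure (Matrix ι ι ℂ)) : Prop where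
  isProbabilityMeasure : IsProbabilityMeasure μ
  ae_mem : ∀ᵐ U ∂μ, U ∈ formGroup S
  map_mul_left : ∀ V ∈ formGroup S, μ.map (fun U => V * U) = μ

lemma isCompact_formGroup (S : Matrix ι ι ℂ) : IsCompact (formGroup S) := by
  have hc : IsCompact (X := Matrix ι ι ℂ) (Set.univ.pi fun _ : ι => Set.univ.pi fun _ : ι =>
      Metric.closedBall (0 : ℂ) 1) :=
    isCompact_univ_pi fun _ => isCompact_univ_pi fun _ => isCompact_closedBall 0 1
  refine hc.of_isClosed_subset ?_ ?_
  · have h : formGroup S = {U | star U * U = 1} ∩ {U | U * star U = 1} ∩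
        ({U | U * S * Uᵀ = S} ∩ {U | Uᵀ * S * U = S}) := by
      ext U
      simp only [formGroup, Matrix.unitaryGroup, Unitary.mem_iff, Set.mem_ofPred_eq, Set.mem_inter_iff]
    rw [h]
    refine ((isClosed_eq ?_ continuous_const).inter (isClosed_eq ?_ continuous_const)).inter
      ((isClosed_eq ?_ continuous_const).inter (isClosed_eq ?_ continuous_const)) <;>
    (try simp only [star_eq_conjTranspose]) <;> fun_prop
  · intro U hU i _ j _
    rw [mem_closedBall_zero_iff]
    exact entry_norm_bound_of_unitary hU.1 i j

namespace IsFormHaar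

variable {S : Matrix ι ι ℂ} {μ : Measure (Matrix ι ι ℂ)}

lemma integrable (hμ : IsFormHaar S μ) {E : Type*} [NormedAddCommGroup E]
    {φ : Matrix ι ι ℂ → E} (hφ : Continuous φ) : Integrable φ μ := by
  have := hμ.isProbabilityMeasure
  have h := hφ.continuousOn.integrableOn_compact (μ := μ) (isCompact_formGroup S)
  rwa [IntegrableOn, Measure.restrict_eq_self_of_ae_mem hμ.ae_mem] at h

lemma exists_bound (S : Matrix ι ι ℂ) {E : Type*} [NormedAddCommGroup E]
    {φ : Matrix ι ι ℂ → E} (hφ : Continuous φ) : ∃ C, ∀ U ∈ formGroup S, ‖φ U‖ ≤ C :=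
  (isCompact_formGroup S).exists_bound_of_continuousOn hφ.continuousOn

end IsFormHaar

lemma mul_mem_formGroup {S U V : Matrix ι ι ℂ} (hV : V ∈ formGroup S) (hU : U ∈ formGroup S) :
    V * U ∈ formGroup S := by
  refine ⟨mul_mem hV.1 hU.1, ?_, ?_⟩
  · rw [transpose_mul, show V * U * S * (Uᵀ * Vᵀ) = V * (U * S * Uᵀ) * Vᵀ by noncomm_ring, hU.2.1,
      hV.2.1]
  · rw [transpose_mul, show Uᵀ * Vᵀ * S * (V * U) = Uᵀ * (Vᵀ * S * V) * U by noncomm_ring, hV.2.2,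
      hU.2.2]

section Exp

attribute [local instance] Matrix.linftyOpNormedRing Matrix.linftyOpNormedAlgebra

lemma hasDerivAt_exp_smul_mul_apply (X U : Matrix ι ι ℂ) (t : ℝ) (a b : ι) :
    HasDerivAt (fun u : ℝ => (NormedSpace.exp (u • X) * U) a b)
      ((X * (NormedSpace.exp (t • X) * U)) a b) t := by
  have h := (hasDerivAt_exp_smul_const' (𝕂 := ℝ) X t).mul_const U
  rw [mul_assoc] at h
  exact hasDerivAt_pi.mp (hasDerivAt_pi.mp h a) b

lemma exp_smul_mem_formGroup {ε : ℤ} {S X : Matrix ι ι ℂ} (hS : IsForm ε S) (h1 : Xᴴ = -X)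
    (h2 : X * S + S * Xᵀ = 0) (t : ℝ) : NormedSpace.exp (t • X) ∈ formGroup S := by
  set Y := NormedSpace.exp (t • X) with hY
  have e1 : Yᴴ = NormedSpace.exp (-(t • X)) := by
    rw [hY, ← Matrix.exp_conjTranspose, conjTranspose_smul, h1, star_trivial, smul_neg]
  have hSinv : S⁻¹ = Sᵀ := inv_eq_right_inv hS.mul_transpose
  have hSu : IsUnit S := IsUnit.of_mul_eq_one _ hS.mul_transpose
  have h3 : S * Xᵀ * S⁻¹ = -X := by
    rw [show S * Xᵀ = -(X * S) from eq_neg_of_add_eq_zero_right h2, hSinv, neg_mul, mul_assoc,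
      hS.mul_transpose, mul_one]
  have e2 : S * Yᵀ * S⁻¹ = NormedSpace.exp (-(t • X)) := by
    rw [hY, ← Matrix.exp_transpose, ← Matrix.exp_conj _ _ hSu, transpose_smul, mul_smul_comm,
      smul_mul_assoc, h3, smul_neg]
  have e3 : Y * NormedSpace.exp (-(t • X)) = 1 := by
    rw [hY, ← Matrix.exp_add_of_commute _ _ (Commute.refl (t • X)).neg_right, add_neg_cancel,
      NormedSpace.exp_zero]
  have e4 : NormedSpace.exp (-(t • X)) * Y = 1 := mul_eq_one_comm.mp e3
  have e5 : Y * S * Yᵀ = S := by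
    have : Y * (S * Yᵀ * S⁻¹) * S = S := by rw [e2, e3, one_mul]
    rwa [hSinv, show Y * (S * Yᵀ * Sᵀ) * S = Y * S * Yᵀ * (Sᵀ * S) by noncomm_ring,
      hS.transpose_mul, mul_one] at this
  have e6 : Yᵀ * S * Y = S := by
    have e7 : Yᵀ = Sᵀ * NormedSpace.exp (-(t • X)) * S := by
      rw [← e2, hSinv, show Sᵀ * (S * Yᵀ * Sᵀ) * S = (Sᵀ * S) * Yᵀ * (Sᵀ * S) by noncomm_ring,
        hS.transpose_mul, one_mul, mul_one]
    rw [e7, show Sᵀ * NormedSpace.exp (-(t • X)) * S * S * Y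
      = Sᵀ * NormedSpace.exp (-(t • X)) * (S * S) * Y by noncomm_ring, hS.mul_self,
      mul_smul_comm, mul_one, smul_mul_assoc, mul_assoc, e4, mul_one, hS.transpose_eq, smul_smul,
      hS.sign_mul_sign, one_smul]
  refine ⟨?_, e5, e6⟩
  rw [mem_unitaryGroup_iff, star_eq_conjTranspose, e1, e3]

end Exp

/-- The integral of a derivative along a one-parameter subgroup vanishes. -/
lemma IsFormHaar.integral_deriv_eq_zero {ε : ℤ} {S X : Matrix ι ι ℂ} {μ : Measure (Matrix ι ι ℂ)}
    (hS : IsForm ε S) (hμ : IsFormHaar S μ) (h1 : Xᴴ = -X) (h2 : X * S + S * Xᵀ = 0)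
    {φ D : Matrix ι ι ℂ → ℂ} (hφ : Continuous φ) (hD : Continuous D)
    (h : ∀ U (t : ℝ), HasDerivAt (fun t : ℝ => φ (NormedSpace.exp (t • X) * U))
      (D (NormedSpace.exp (t • X) * U)) t) : ∫ U, D U ∂μ = 0 := by
  have := hμ.isProbabilityMeasure
  obtain ⟨C, hC⟩ := IsFormHaar.exists_bound S hD
  have hmul : ∀ V : Matrix ι ι ℂ, Continuous fun U : Matrix ι ι ℂ => V * U := fun V => by fun_prop
  have key := hasDerivAt_integral_of_dominated_loc_of_deriv_le (μ := μ) (𝕜 := ℝ) (x₀ := 0)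
    (s := Set.univ) (bound := fun _ => C)
    (F := fun t U => φ (NormedSpace.exp (t • X) * U))
    (F' := fun t U => D (NormedSpace.exp (t • X) * U)) univ_mem
    (Eventually.of_forall fun t => (hμ.integrable (hφ.comp (hmul _))).aestronglyMeasurable)
    (hμ.integrable (hφ.comp (hmul _))) (hμ.integrable (hD.comp (hmul _))).aestronglyMeasurable
    (by
      filter_upwards [hμ.ae_mem] with U hU t _
      exact hC _ (mul_mem_formGroup (exp_smul_mem_formGroup hS h1 h2 t) hU))
    (integrable_const C) (Eventually.of_forall fun U t _ => h U t)
  have hconst : ∀ t : ℝ, ∫ U, φ (NormedSpace.exp (t • X) * U) ∂μ = ∫ U, φ U ∂μ := fun t => by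
    nth_rw 2 [← hμ.map_mul_left _ (exp_smul_mem_formGroup hS h1 h2 t)]
    rw [integral_map (hmul _).aemeasurable]
    rw [hμ.map_mul_left _ (exp_smul_mem_formGroup hS h1 h2 t)]
    exact (hμ.integrable hφ).aestronglyMeasurable
  have h0 := key.2
  simp only [hconst] at h0
  have := h0.unique (hasDerivAt_const _ _)
  simpa using this

end Haar

section LoopEquation

variable {ι : Type*} [Fintype ι] [DecidableEq ι]

/-- The `j`-th power sum as a polynomial in power sums; the zeroth one is the dimension. -/
def powerSumVar (d j : ℕ) : MvPolynomial ℕ ℝ :=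
  if j = 0 then MvPolynomial.C (d : ℝ) else MvPolynomial.X j

/-- The derivation `j ∂/∂p_j`. -/
def scaledPderiv (j : ℕ) : MvPolynomial ℕ ℝ →+ MvPolynomial ℕ ℝ :=
  j • (MvPolynomial.pderiv (R := ℝ) j).toLinearMap.toAddMonoidHom

lemma scaledPderiv_apply (j : ℕ) (f : MvPolynomial ℕ ℝ) :
    scaledPderiv j f = j • MvPolynomial.pderiv j f := rfl

lemma isDer_scaledPderiv (j : ℕ) : IsDer (scaledPderiv j) := by
  intro a b
  simp only [scaledPderiv_apply, Derivation.leibniz, smul_eq_mul, nsmul_eq_mul]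
  ring

lemma scaledPderiv_powerSumVar (d : ℕ) {j : ℕ} (hj : 1 ≤ j) (i : ℕ) :
    scaledPderiv j (powerSumVar d i) = if i = j then (j : MvPolynomial ℕ ℝ) else 0 := by
  rw [scaledPderiv_apply, powerSumVar]
  by_cases hi : i = 0
  · rw [if_pos hi, if_neg (by omega), MvPolynomial.pderiv_C, smul_zero]
  · rw [if_neg hi, MvPolynomial.pderiv_X]
    by_cases h : i = j
    · simp [h]
    · simp [h]

/-- Evaluation of polynomials in power sums at a matrix. -/
def traceEval (U : Matrix ι ι ℂ) : MvPolynomial ℕ ℝ →ₐ[ℝ] ℂ :=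
  MvPolynomial.aeval fun j => trace (U ^ j)

/-- Evaluation of polynomials in power sums at the real parts of the power sums of a matrix. -/
def reTraceEval (U : Matrix ι ι ℂ) : MvPolynomial ℕ ℝ →ₐ[ℝ] ℝ :=
  MvPolynomial.aeval fun j => (trace (U ^ j)).re

lemma traceEval_powerSumVar (U : Matrix ι ι ℂ) (j : ℕ) :
    traceEval U (powerSumVar (Fintype.card ι) j) = trace (U ^ j) := by
  rw [traceEval, powerSumVar]
  split_ifs with h
  · simp [h]
  · simp

lemma reTraceEval_powerSumVar (U : Matrix ι ι ℂ) (j : ℕ) :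
    reTraceEval U (powerSumVar (Fintype.card ι) j) = (trace (U ^ j)).re := by
  rw [reTraceEval, powerSumVar]
  split_ifs with h
  · simp [h]
  · simp

lemma IsForm.ofReal_reTraceEval {ε : ℤ} {S U : Matrix ι ι ℂ} (hS : IsForm ε S)
    (hU : U ∈ formGroup S) (f : MvPolynomial ℕ ℝ) : (reTraceEval U f : ℂ) = traceEval U f := by
  have h : Complex.ofRealAm.comp (reTraceEval U) = traceEval U := by
    refine MvPolynomial.algHom_ext fun j => ?_
    simp [reTraceEval, traceEval, hS.ofReal_re_trace hU]
  exact congrArg (fun φ => φ f) h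

lemma continuous_aeval_apply {X R : Type*} [TopologicalSpace X] [CommRing R] [TopologicalSpace R]
    [IsTopologicalRing R] [Algebra ℝ R] {x : X → ℕ → R} (hx : ∀ j, Continuous fun t => x t j)
    (f : MvPolynomial ℕ ℝ) : Continuous fun t => MvPolynomial.aeval (x t) f := by
  induction f using MvPolynomial.induction_on with
  | C a => simpa using continuous_const
  | add p q hp hq => simpa using! hp.add hq
  | mul_X p n hp => simpa using! hp.mul (hx n)

lemma continuous_traceEval (f : MvPolynomial ℕ ℝ) :
    Continuous fun U : Matrix ι ι ℂ => traceEval U f :=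
  continuous_aeval_apply (fun j => by fun_prop) f

lemma continuous_reTraceEval (f : MvPolynomial ℕ ℝ) :
    Continuous fun U : Matrix ι ι ℂ => reTraceEval U f :=
  continuous_aeval_apply (fun j => by fun_prop) f

/-- The entrywise derivative of a power along a right-invariant vector field. -/
lemma hasDerivAt_pow_apply {A : ℝ → Matrix ι ι ℂ} {X : Matrix ι ι ℂ} {t : ℝ}
    (hA : ∀ a b, HasDerivAt (fun u => A u a b) ((X * A t) a b) t) (m : ℕ) (a b : ι) :
    HasDerivAt (fun u => (A u ^ m) a b)
      (∑ i ∈ Finset.range m, (A t ^ i * X * A t ^ (m - i)) a b) t := by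
  induction m generalizing a b with
  | zero => simpa using hasDerivAt_const t _
  | succ m ih =>
    simp only [pow_succ _ m, Matrix.mul_apply (M := A _ ^ m)]
    refine (HasDerivAt.fun_sum fun c _ => (ih a c).mul (hA c b)).congr_deriv ?_
    rw [Finset.sum_add_distrib, ← Matrix.mul_apply, Finset.sum_range_succ, add_tsub_cancel_left,
      pow_one, mul_assoc]
    congr 1
    simp only [Finset.sum_mul]
    rw [Finset.sum_comm]
    refine Finset.sum_congr rfl fun i hi => ?_
    rw [← Matrix.mul_apply, Nat.sub_add_comm (Finset.mem_range.mp hi).le, pow_succ, ← mul_assoc]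

lemma hasDerivAt_trace_pow {A : ℝ → Matrix ι ι ℂ} {X : Matrix ι ι ℂ} {t : ℝ}
    (hA : ∀ a b, HasDerivAt (fun u => A u a b) ((X * A t) a b) t) (m : ℕ) :
    HasDerivAt (fun u => trace (A u ^ m)) (m * trace (X * A t ^ m)) t := by
  refine (HasDerivAt.fun_sum fun a _ => hasDerivAt_pow_apply hA m a a).congr_deriv ?_
  rw [Finset.sum_comm, Finset.sum_congr rfl (g := fun _ => trace (X * A t ^ m)), Finset.sum_const,
    Finset.card_range, nsmul_eq_mul]
  intro i hi
  change trace (A t ^ i * X * A t ^ (m - i)) = _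
  rw [mul_assoc, trace_mul_comm, mul_assoc, ← pow_add, Nat.sub_add_cancel (Finset.mem_range.mp hi).le]

lemma eventually_hasDerivAt_aeval {x : ℝ → ℕ → ℂ} {x' : ℕ → ℂ} {t : ℝ}
    (hx : ∀ j, HasDerivAt (fun u => x u j) (x' j) t) (f : MvPolynomial ℕ ℝ) :
    ∀ᶠ N in atTop, HasDerivAt (fun u => MvPolynomial.aeval (x u) f)
      (∑ j ∈ Finset.range N, MvPolynomial.aeval (x t) (MvPolynomial.pderiv j f) * x' j) t := by
  induction f using MvPolynomial.induction_on with
  | C a => exact Eventually.of_forall fun _ => by simpa using hasDerivAt_const t (a : ℂ)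
  | add p q hp hq =>
    filter_upwards [hp, hq] with N h1 h2
    simpa [add_mul, Finset.sum_add_distrib] using! h1.add h2
  | mul_X p n hp =>
    filter_upwards [hp, eventually_gt_atTop n] with N h1 h2
    simp only [map_mul, MvPolynomial.aeval_X]
    refine (h1.mul (hx n)).congr_deriv ?_
    simp only [Derivation.leibniz, smul_eq_mul, map_add, map_mul, MvPolynomial.aeval_X,
      MvPolynomial.pderiv_X, add_mul, Finset.sum_add_distrib]
    rw [add_comm]
    congr 1
    · rw [Finset.sum_eq_single n]
      · simp
      · intro j _ hj
        simp [hj.symm]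
      · intro h
        exact absurd (Finset.mem_range.mpr h2) h
    · rw [Finset.sum_mul]
      refine Finset.sum_congr rfl fun j _ => by ring

lemma hasDerivAt_traceEval {A : ℝ → Matrix ι ι ℂ} {X : Matrix ι ι ℂ} {t : ℝ}
    (hA : ∀ a b, HasDerivAt (fun u => A u a b) ((X * A t) a b) t) {f : MvPolynomial ℕ ℝ} {J : ℕ}
    (hJ : ∀ j, J < j → scaledPderiv j f = 0) :
    HasDerivAt (fun u => traceEval (A u) f)
      (∑ j ∈ Finset.Icc 1 J, traceEval (A t) (scaledPderiv j f) * trace (X * A t ^ j)) t := by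
  obtain ⟨N, h, hN⟩ := ((eventually_hasDerivAt_aeval (hasDerivAt_trace_pow hA) f).and
    (eventually_gt_atTop J)).exists
  refine h.congr_deriv ?_
  rw [Finset.sum_congr rfl
    (g := fun j => traceEval (A t) (scaledPderiv j f) * trace (X * A t ^ j))]
  · symm
    refine Finset.sum_subset ?_ ?_
    · intro j hj
      rw [Finset.mem_Icc] at hj
      rw [Finset.mem_range]
      omega
    · intro j _ hj
      rw [Finset.mem_Icc] at hj
      rcases Nat.eq_zero_or_pos j with rfl | hj0
      · simp [scaledPderiv_apply]
      · rw [hJ j (by omega), map_zero, zero_mul]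
  · intro j _
    rw [scaledPderiv_apply, map_nsmul, traceEval, nsmul_eq_mul]
    ring

/-- The derivative of `(U ^ m) a b * f(U)` along the right-invariant vector field of `X`. -/
def loopDeriv (f : MvPolynomial ℕ ℝ) (J m : ℕ) (a b : ι) (U X : Matrix ι ι ℂ) : ℂ :=
  (∑ i ∈ Finset.range m, (U ^ i * X * U ^ (m - i)) a b) * traceEval U f
    + (U ^ m) a b *
      ∑ j ∈ Finset.Icc 1 J, traceEval U (scaledPderiv j f) * trace (X * U ^ j)

lemma loopDeriv_add (f : MvPolynomial ℕ ℝ) (J m : ℕ) (a b : ι) (U X Y : Matrix ι ι ℂ) :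
    loopDeriv f J m a b U (X + Y) = loopDeriv f J m a b U X + loopDeriv f J m a b U Y := by
  simp only [loopDeriv, mul_add, add_mul, Matrix.add_apply, trace_add, Finset.sum_add_distrib]
  ring

lemma loopDeriv_smul (f : MvPolynomial ℕ ℝ) (J m : ℕ) (a b : ι) (U X : Matrix ι ι ℂ) (c : ℂ) :
    loopDeriv f J m a b U (c • X) = c * loopDeriv f J m a b U X := by
  simp only [loopDeriv, mul_smul_comm, smul_mul_assoc, Matrix.smul_apply, smul_eq_mul, trace_smul,
    ← Finset.mul_sum, mul_left_comm _ c]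
  ring

lemma continuous_loopDeriv (f : MvPolynomial ℕ ℝ) (J m : ℕ) (a b : ι) (X : Matrix ι ι ℂ) :
    Continuous fun U => loopDeriv f J m a b U X := by
  have h := fun f => continuous_traceEval (ι := ι) f
  unfold loopDeriv
  fun_prop

/-- The projection of a matrix to the Lie algebra of the group of the form `S`. -/
def toLieAlgebra (S A : Matrix ι ι ℂ) : Matrix ι ι ℂ := A - S * Aᵀ * Sᵀ

lemma IsFormHaar.integral_loopDeriv_of_skew {ε : ℤ} {S : Matrix ι ι ℂ}
    {μ : Measure (Matrix ι ι ℂ)} (hS : IsForm ε S) (hμ : IsFormHaar S μ)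
    {f : MvPolynomial ℕ ℝ} {J : ℕ} (hJ : ∀ j, J < j → scaledPderiv j f = 0) (m : ℕ) (a b : ι)
    {A : Matrix ι ι ℂ} (hA : Aᴴ = -A) :
    ∫ U, loopDeriv f J m a b U (toLieAlgebra S A) ∂μ = 0 := by
  have hAt : Aᵀᴴ = -Aᵀ := by
    rw [← transpose_neg, ← hA]
    rfl
  refine hμ.integral_deriv_eq_zero (X := toLieAlgebra S A) hS (φ := fun U => (U ^ m) a b * traceEval U f) ?_ ?_ ?_
    (continuous_loopDeriv f J m a b _) fun U t => ?_
  · have hSS : Sᵀᴴ = S := by rw [← hS.conjTranspose_eq, conjTranspose_conjTranspose]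
    rw [toLieAlgebra, conjTranspose_sub, conjTranspose_mul, conjTranspose_mul, hA, hSS, hAt,
      hS.conjTranspose_eq]
    noncomm_ring
  · rw [toLieAlgebra, transpose_sub, transpose_mul, transpose_mul, transpose_transpose,
      transpose_transpose, sub_mul, mul_assoc (S * Aᵀ), hS.transpose_mul, mul_sub,
      ← mul_assoc S S, hS.mul_self, hS.transpose_eq, smul_mul_assoc, one_mul, mul_smul_comm,
      smul_smul, hS.sign_mul_sign, one_smul]
    noncomm_ring
  · have := continuous_traceEval (ι := ι) f
    fun_prop
  · have h := hasDerivAt_exp_smul_mul_apply (toLieAlgebra S A) U t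
    exact (hasDerivAt_pow_apply h m a b).mul (hasDerivAt_traceEval h hJ)

lemma IsFormHaar.integral_loopDeriv {ε : ℤ} {S : Matrix ι ι ℂ}
    {μ : Measure (Matrix ι ι ℂ)} (hS : IsForm ε S) (hμ : IsFormHaar S μ)
    {f : MvPolynomial ℕ ℝ} {J : ℕ} (hJ : ∀ j, J < j → scaledPderiv j f = 0) (m : ℕ) (a b : ι)
    (A : Matrix ι ι ℂ) : ∫ U, loopDeriv f J m a b U (toLieAlgebra S A) ∂μ = 0 := by
  set A₁ := (1 / 2 : ℂ) • (A - Aᴴ) with h1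
  set A₂ := (-Complex.I / 2) • (A + Aᴴ) with h2
  have e1 : A₁ᴴ = -A₁ := by
    rw [h1, conjTranspose_smul, conjTranspose_sub, conjTranspose_conjTranspose, ← smul_neg, neg_sub]
    simp
  have e2 : A₂ᴴ = -A₂ := by
    rw [h2, conjTranspose_smul, conjTranspose_add, conjTranspose_conjTranspose, ← neg_smul,
      add_comm]
    simp [neg_div]
  have e : toLieAlgebra S A = toLieAlgebra S A₁ + Complex.I • toLieAlgebra S A₂ := by
    have eA : A = A₁ + Complex.I • A₂ := by
      rw [h1, h2, smul_smul, show Complex.I * (-Complex.I / 2) = 1 / 2 by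
        rw [mul_div_assoc', mul_neg, Complex.I_mul_I, neg_neg], ← smul_add]
      rw [show A - Aᴴ + (A + Aᴴ) = (2 : ℂ) • A by rw [two_smul]; abel, smul_smul]
      norm_num
    nth_rw 1 [eA]
    simp only [toLieAlgebra, transpose_add, transpose_smul, mul_add, add_mul, mul_smul_comm,
      smul_mul_assoc, smul_sub]
    abel
  simp only [e, loopDeriv_add, loopDeriv_smul]
  rw [integral_add (hμ.integrable (continuous_loopDeriv _ _ _ _ _ _))
    ((hμ.integrable (continuous_loopDeriv _ _ _ _ _ _)).const_mul _), integral_const_mul,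
    hμ.integral_loopDeriv_of_skew hS hJ m a b e1, hμ.integral_loopDeriv_of_skew hS hJ m a b e2,
    mul_zero, add_zero]

end LoopEquation

section TraceMoments

variable {ι : Type*} [Fintype ι] [DecidableEq ι]

lemma mul_single_one_mul_apply {R : Type*} [CommRing R] (P Q : Matrix ι ι R) (a b u v : ι) :
    (P * Matrix.single u v (1 : R) * Q : Matrix ι ι R) a b = P a u * Q v b := by
  rw [Matrix.mul_apply, Finset.sum_eq_single v]
  · rw [Matrix.mul_apply, Finset.sum_eq_single u] <;> simp +contextual [eq_comm]
  · intro c _ hc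
    rw [Matrix.mul_apply, Finset.sum_eq_zero, zero_mul]
    intro e _
    simp [hc.symm]
  · simp

omit [DecidableEq ι] in
lemma sum_mul_apply_eq_trace {R : Type*} [CommRing R] (P Q : Matrix ι ι R) :
    ∑ a, ∑ b, P a b * Q a b = trace (P * Qᵀ) := by
  simp only [trace, diag_apply, Matrix.mul_apply, transpose_apply]

lemma toLieAlgebra_single (S : Matrix ι ι ℂ) (a b : ι) :
    toLieAlgebra S (Matrix.single a b 1)
      = Matrix.single a b 1 - S * Matrix.single b a 1 * Sᵀ := by
  rw [toLieAlgebra, transpose_single]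

lemma sum_mul_toLieAlgebra_mul (S P Q : Matrix ι ι ℂ) :
    ∑ a, ∑ b, (P * toLieAlgebra S (Matrix.single a b 1) * Q) a b
      = trace P * trace Q - trace ((P * S)ᵀ * (Sᵀ * Q)) := by
  have h : ∀ a b, (P * toLieAlgebra S (Matrix.single a b 1) * Q) a b
      = P a a * Q b b - (P * S) a b * (Sᵀ * Q) a b := fun a b => by
    rw [toLieAlgebra_single, mul_sub, sub_mul, Matrix.sub_apply, mul_single_one_mul_apply,
      show P * (S * Matrix.single b a 1 * Sᵀ) * Q = P * S * Matrix.single b a 1 * (Sᵀ * Q) by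
        noncomm_ring, mul_single_one_mul_apply]
  simp only [h, Finset.sum_sub_distrib]
  rw [sum_mul_apply_eq_trace, ← trace_transpose, transpose_mul, transpose_transpose,
    trace_mul_comm (Sᵀ * Q)]
  congr 1
  simp only [trace, diag_apply, Finset.sum_mul_sum]

lemma sum_mul_trace_toLieAlgebra_mul (S P Q : Matrix ι ι ℂ) :
    ∑ a, ∑ b, P a b * trace (toLieAlgebra S (Matrix.single a b 1) * Q)
      = trace (P * Q) - trace (P * (Sᵀ * Q * S)ᵀ) := by
  have ht : ∀ (R : Matrix ι ι ℂ) a b, trace (Matrix.single a b 1 * R) = R b a := fun R a b => by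
    rw [trace_single_mul, one_smul]
  have h : ∀ a b, P a b * trace (toLieAlgebra S (Matrix.single a b 1) * Q)
      = P a b * Qᵀ a b - P a b * (Sᵀ * Q * S) a b := fun a b => by
    rw [toLieAlgebra_single, sub_mul, trace_sub, ht,
      show S * Matrix.single b a 1 * Sᵀ * Q = S * (Matrix.single b a 1 * (Sᵀ * Q)) by noncomm_ring,
      trace_mul_comm S, mul_assoc, ht, mul_sub]
    rfl
  simp only [h, Finset.sum_sub_distrib, sum_mul_apply_eq_trace, transpose_transpose]

namespace IsForm

variable {ε : ℤ} {S U : Matrix ι ι ℂ}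

lemma trace_conjTranspose_pow_mul (hS : IsForm ε S) (hU : U ∈ formGroup S) (i k : ℕ) :
    trace (Uᴴ ^ i * U ^ k) = trace (U ^ ((i - k) + (k - i))) := by
  have hc : Commute Uᴴ U := by
    rw [Commute, SemiconjBy, conjTranspose_mul_self hU, mul_conjTranspose_self hU]
  have h1 : ∀ j, Uᴴ ^ j * U ^ j = 1 := fun j => by
    rw [← hc.mul_pow, conjTranspose_mul_self hU, one_pow]
  rcases le_total i k with h | h
  · obtain ⟨l, rfl⟩ := Nat.exists_eq_add_of_le h
    rw [pow_add, ← mul_assoc, h1, one_mul]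
    congr 2
    omega
  · obtain ⟨l, rfl⟩ := Nat.exists_eq_add_of_le h
    rw [add_comm k l, pow_add, mul_assoc, h1, mul_one, hS.trace_conjTranspose_pow hU]
    congr 2
    omega

lemma sum_loopDeriv (hS : IsForm ε S) (hU : U ∈ formGroup S) (f : MvPolynomial ℕ ℝ) (J m : ℕ) :
    ∑ a, ∑ b, loopDeriv f J m a b U (toLieAlgebra S (Matrix.single a b 1))
      = traceEval U f * loopP ε (fun k => trace (U ^ k)) m
        - ∑ j ∈ Finset.Icc 1 J,
            traceEval U (scaledPderiv j f) * loopQ (fun k => trace (U ^ k)) m j := by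
  have h1 : ∀ i ∈ Finset.range m, trace ((U ^ i * S)ᵀ * (Sᵀ * U ^ (m - i)))
      = ε * trace (U ^ ((m - 2 * i) + (2 * i - m))) := by
    intro i hi
    rw [Finset.mem_range] at hi
    have e : (U ^ i * S)ᵀ * (Sᵀ * U ^ (m - i)) = (ε : ℂ) • (Uᴴ ^ i * U ^ (m - i)) := by
      rw [hS.conjTranspose_pow_eq hU, Matrix.transpose_mul, ← mul_assoc, transpose_pow]
      nth_rw 1 [hS.transpose_eq]
      rw [smul_mul_assoc, smul_mul_assoc, smul_mul_assoc]
    rw [e, trace_smul, smul_eq_mul, hS.trace_conjTranspose_pow_mul hU]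
    congr 3
    omega
  have h2 : ∀ j, trace (U ^ m * U ^ j) - trace (U ^ m * (Sᵀ * U ^ j * S)ᵀ)
      = -loopQ (fun k => trace (U ^ k)) m j := by
    intro j
    have e : (Sᵀ * U ^ j * S)ᵀ = Uᴴ ^ j := by
      have hS' : S = (ε : ℂ) • Sᵀ := by
        rw [hS.transpose_eq, smul_smul, hS.sign_mul_sign, one_smul]
      rw [hS.conjTranspose_pow_eq hU, Matrix.transpose_mul, Matrix.transpose_mul, transpose_transpose,
        transpose_pow, hS.transpose_eq, smul_mul_assoc, mul_smul_comm, ← mul_assoc]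
    rw [e, ← pow_add, trace_mul_comm, hS.trace_conjTranspose_pow_mul hU, loopQ, neg_sub,
      add_comm (j - m)]
  calc ∑ a, ∑ b, loopDeriv f J m a b U (toLieAlgebra S (Matrix.single a b 1))
      = (∑ i ∈ Finset.range m, ∑ a, ∑ b,
          (U ^ i * toLieAlgebra S (Matrix.single a b 1) * U ^ (m - i)) a b) * traceEval U f
        + ∑ j ∈ Finset.Icc 1 J, traceEval U (scaledPderiv j f) * ∑ a, ∑ b,
            (U ^ m) a b * trace (toLieAlgebra S (Matrix.single a b 1) * U ^ j) := by
        have hc : ∀ (s : Finset ℕ) (F : ι → ι → ℕ → ℂ), ∑ a, ∑ b, ∑ i ∈ s, F a b i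
            = ∑ i ∈ s, ∑ a, ∑ b, F a b i := fun s F => by
          rw [Finset.sum_comm (s := s)]
          exact Finset.sum_congr rfl fun a _ => Finset.sum_comm
        simp only [loopDeriv, Finset.sum_add_distrib]
        congr 1
        · rw [← hc]
          simp only [Finset.sum_mul]
        · simp only [Finset.mul_sum]
          rw [hc]
          exact Finset.sum_congr rfl fun j _ => Finset.sum_congr rfl fun a _ =>
            Finset.sum_congr rfl fun b _ => mul_left_comm _ _ _
    _ = _ := by
        simp only [sum_mul_toLieAlgebra_mul, sum_mul_trace_toLieAlgebra_mul, h2, mul_neg,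
          Finset.sum_neg_distrib]
        rw [Finset.sum_congr rfl fun i hi => by rw [h1 i hi], ← sub_eq_add_neg, mul_comm]
        simp only [loopP]

end IsForm

section Map

variable {B B' : Type*} [CommRing B] [CommRing B'] (φ : B →+* B')

lemma map_loopP_apply (ε : ℤ) (p : ℕ → B) (m : ℕ) :
    φ (loopP ε p m) = loopP ε (fun j => φ (p j)) m := by
  simp [loopP]

lemma map_loopQ_apply (p : ℕ → B) (i j : ℕ) :
    φ (loopQ p i j) = loopQ (fun j => φ (p j)) i j := by
  simp [loopQ]

end Map

namespace IsFormHaar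

variable {ε : ℤ} {S : Matrix ι ι ℂ} {μ : Measure (Matrix ι ι ℂ)}

lemma integrable_reTraceEval (hμ : IsFormHaar S μ) (f : MvPolynomial ℕ ℝ) :
    Integrable (fun U => reTraceEval U f) μ :=
  hμ.integrable (continuous_reTraceEval f)

/-- The expectation of a polynomial in power sums. -/
def expect (hμ : IsFormHaar S μ) : MvPolynomial ℕ ℝ →+ ℝ where
  toFun f := ∫ U, reTraceEval U f ∂μ
  map_zero' := by simp
  map_add' f g := by
    simp only [map_add]
    exact integral_add (hμ.integrable_reTraceEval f) (hμ.integrable_reTraceEval g)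

lemma expect_apply (hμ : IsFormHaar S μ) (f : MvPolynomial ℕ ℝ) :
    hμ.expect f = ∫ U, reTraceEval U f ∂μ := rfl

lemma ofReal_expect (hS : IsForm ε S) (hμ : IsFormHaar S μ) (f : MvPolynomial ℕ ℝ) :
    (hμ.expect f : ℂ) = ∫ U, traceEval U f ∂μ := by
  rw [expect_apply, ← integral_complex_ofReal]
  refine integral_congr_ae ?_
  filter_upwards [hμ.ae_mem] with U hU using hS.ofReal_reTraceEval hU f

lemma expect_mul_loopP (hS : IsForm ε S) (hμ : IsFormHaar S μ) {f : MvPolynomial ℕ ℝ} {J : ℕ}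
    (hJ : ∀ j, J < j → scaledPderiv j f = 0) (m : ℕ) :
    hμ.expect (f * loopP ε (powerSumVar (Fintype.card ι)) m)
      = ∑ j ∈ Finset.Icc 1 J,
          hμ.expect (scaledPderiv j f * loopQ (powerSumVar (Fintype.card ι)) m j) := by
  have hint := fun g => hμ.integrable (continuous_traceEval (ι := ι) g)
  have h0 : ∫ U, ∑ a, ∑ b, loopDeriv f J m a b U (toLieAlgebra S (Matrix.single a b 1)) ∂μ = 0 := by
    have hi := fun a b => hμ.integrable
      (continuous_loopDeriv f J m a b (toLieAlgebra S (Matrix.single a b 1)))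
    rw [integral_finsetSum _ fun a _ => integrable_finsetSum _ fun b _ => hi a b]
    refine Finset.sum_eq_zero fun a _ => ?_
    rw [integral_finsetSum _ fun b _ => hi a b]
    exact Finset.sum_eq_zero fun b _ => hμ.integral_loopDeriv hS hJ m a b _
  have h1 : ∫ U, (traceEval U (f * loopP ε (powerSumVar (Fintype.card ι)) m)
      - ∑ j ∈ Finset.Icc 1 J,
        traceEval U (scaledPderiv j f * loopQ (powerSumVar (Fintype.card ι)) m j)) ∂μ = 0 := by
    rw [← h0]
    refine integral_congr_ae ?_
    filter_upwards [hμ.ae_mem] with U hU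
    rw [hS.sum_loopDeriv hU]
    have hp : (fun j => (traceEval U : MvPolynomial ℕ ℝ →+* ℂ) (powerSumVar (Fintype.card ι) j))
        = fun j => trace (U ^ j) := funext fun j => traceEval_powerSumVar U j
    have e1 := map_loopP_apply (traceEval U : MvPolynomial ℕ ℝ →+* ℂ) ε
      (powerSumVar (Fintype.card ι)) m
    have e2 := fun j => map_loopQ_apply (traceEval U : MvPolynomial ℕ ℝ →+* ℂ)
      (powerSumVar (Fintype.card ι)) m j
    rw [hp] at e1
    simp only [hp] at e2
    simp only [RingHom.coe_coe] at e1 e2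
    simp only [map_mul, e1, e2]
  rw [integral_sub (hint _) (integrable_finsetSum _ fun j _ => hint _),
    integral_finsetSum _ fun j _ => hint _] at h1
  simp only [← ofReal_expect hS hμ] at h1
  exact_mod_cast sub_eq_zero.mp h1

lemma isLoopFunctional (hS : IsForm ε S) (hμ : IsFormHaar S μ) {M : ℕ}
    (hM : (M : ℤ) + ε = Fintype.card ι) :
    IsLoopFunctional ε M (powerSumVar (Fintype.card ι)) scaledPderiv hμ.expect := by
  have := hμ.isProbabilityMeasure
  have hook_eq : ∀ (U : Matrix ι ι ℂ) (α β : ℕ), reTraceEval U (hook ε (powerSumVar (Fintype.card ι)) α β)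
      = hook ε (fun j => (trace (U ^ j)).re) α β := fun U α β => by
    have := map_hook (reTraceEval U : MvPolynomial ℕ ℝ →+* ℝ) ε (powerSumVar (Fintype.card ι)) α β
    simpa only [RingHom.coe_coe, reTraceEval_powerSumVar] using this
  refine ⟨hS.sign, isDer_scaledPderiv, fun j hj i => scaledPderiv_powerSumVar _ hj i, ?_, ?_, ?_,
    fun f J m _ hJ => hμ.expect_mul_loopP hS hJ m, ?_, ?_⟩
  · have h : ((Fintype.card ι : ℤ) : MvPolynomial ℕ ℝ) = M + ε := by rw [← hM]; push_cast; rfl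
    rw [← h, powerSumVar, if_pos rfl]
    simp
  · simp [expect_apply]
  · intro f
    rw [expect_apply]
    refine integral_nonneg fun U => ?_
    rw [map_mul]
    exact mul_self_nonneg _
  · intro α β f hβ
    simp only [expect_apply, map_mul, hook_eq]
    split_ifs with h
    · refine integral_congr_ae ?_
      filter_upwards [hμ.ae_mem] with U hU
      obtain ⟨c, -, hc⟩ := hS.exists_hook_eq hU hM
      rw [hc α β hβ, hc 0 M le_rfl, if_pos h, if_pos (zero_add M)]
    · refine integral_eq_zero_of_ae ?_
      filter_upwards [hμ.ae_mem] with U hU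
      obtain ⟨c, -, hc⟩ := hS.exists_hook_eq hU hM
      rw [hc α β hβ, if_neg h, zero_mul]
      rfl
  · simp only [expect_apply, map_mul, hook_eq]
    rw [integral_congr_ae (g := fun _ => (1 : ℝ))]
    · simp
    · filter_upwards [hμ.ae_mem] with U hU
      obtain ⟨c, hc1, hc⟩ := hS.exists_hook_eq hU hM
      rw [hc 0 M le_rfl, if_pos (zero_add M), ← sq, hc1]

/-- Traces of powers have second moments growing at most linearly, uniformly in the dimension. -/
theorem integral_trace_sq_le (hS : IsForm ε S) (hμ : IsFormHaar S μ) {M : ℕ}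
    (hM : (M : ℤ) + ε = Fintype.card ι) {k : ℕ} (hk : 1 ≤ k) :
    ∫ U, (trace (U ^ k)).re ^ 2 ∂μ ≤ 9 * k := by
  have h := (hμ.isLoopFunctional hS hM).map_apply_mul_self_le hk
  simpa only [expect_apply, map_mul, reTraceEval_powerSumVar, ← sq (Complex.re _)] using h

end IsFormHaar

end TraceMoments

section Assembly

/-- The summable majorant of the weighted second moments. -/
def sobolevWeight (s : ℝ) (j : ℤ) : ℝ := (1 + (j : ℝ) ^ 2) ^ s * (9 * |(j : ℝ)|) / (j : ℝ) ^ 2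

lemma sobolevWeight_nonneg (s : ℝ) (j : ℤ) : 0 ≤ sobolevWeight s j := by
  unfold sobolevWeight
  positivity

lemma summable_sobolevWeight {s : ℝ} (hs : s < 0) : Summable (sobolevWeight s) := by
  have h := (Real.summable_abs_int_rpow (b := 1 - 2 * s) (by linarith)).mul_left 9
  refine Summable.of_nonneg_of_le (sobolevWeight_nonneg s) (fun j => ?_) h
  rcases eq_or_ne j 0 with rfl | hj
  · simp only [sobolevWeight, Int.cast_zero, abs_zero, mul_zero, zero_div]
    positivity
  · have hj' : 0 < |(j : ℝ)| := abs_pos.mpr (Int.cast_ne_zero.mpr hj)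
    have h1 : (1 + (j : ℝ) ^ 2) ^ s ≤ |(j : ℝ)| ^ (2 * s) := by
      rw [Real.rpow_mul hj'.le, Real.rpow_two, sq_abs]
      exact Real.rpow_le_rpow_of_nonpos (by rw [← sq_abs]; positivity) (by linarith) hs.le
    have h2 : |(j : ℝ)| ^ (-(1 - 2 * s)) = |(j : ℝ)| ^ (2 * s) / |(j : ℝ)| := by
      rw [show -(1 - 2 * s) = 2 * s - 1 by ring, Real.rpow_sub hj', Real.rpow_one]
    rw [sobolevWeight, h2, ← sq_abs (j : ℝ), sq, mul_div_assoc, mul_div_mul_right _ _ hj'.ne',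
      mul_div_assoc', mul_div_assoc', mul_comm, ← sq,
      sq_abs]
    gcongr

section Moments

variable {Ω : Type*} [MeasurableSpace Ω] {μ : Measure Ω} {X : ℕ → Ω → ℝ}

lemma tsum_le_tsum_sobolevWeight {s : ℝ} (hs : s < 0)
    (hX : ∀ k, 1 ≤ k → ∫ ω, X k ω ^ 2 ∂μ ≤ 9 * k) :
    (∑' k : ℕ, ((1 + ((k : ℝ) + 1) ^ 2) ^ s) * (∫ ω, X (k + 1) ω ^ 2 ∂μ) / ((k : ℝ) + 1) ^ 2)
      ≤ ∑' j, sobolevWeight s j := by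
  have hinj : Function.Injective fun k : ℕ => ((k : ℤ) + 1) := fun a b h => by
    simpa using h
  have hle : ∀ k : ℕ, ((1 + ((k : ℝ) + 1) ^ 2) ^ s) * (∫ ω, X (k + 1) ω ^ 2 ∂μ) / ((k : ℝ) + 1) ^ 2
      ≤ sobolevWeight s ((k : ℤ) + 1) := fun k => by
    have h := hX (k + 1) (by omega)
    push_cast at h
    have hk : (0 : ℝ) ≤ (k : ℝ) + 1 := by positivity
    rw [sobolevWeight]
    push_cast
    rw [abs_of_nonneg hk]
    gcongr
  have hsum := (summable_sobolevWeight hs).comp_injective hinj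
  refine (Summable.tsum_le_tsum hle (.of_nonneg_of_le (fun k => ?_) hle hsum) hsum).trans
    (tsum_comp_le_tsum_of_inj (summable_sobolevWeight hs) (sobolevWeight_nonneg s) hinj)
  have : 0 ≤ ∫ ω, X (k + 1) ω ^ 2 ∂μ := integral_nonneg fun _ => sq_nonneg _
  positivity

lemma integral_hsNormSq_le {s : ℝ} (hs : s < 0) (hint : ∀ k, Integrable (fun ω => X k ω ^ 2) μ)
    (hX : ∀ k, 1 ≤ k → ∫ ω, X k ω ^ 2 ∂μ ≤ 9 * k) :
    ∫ ω, hsNormSq s (fun k => X k ω) ∂μ ≤ ∑' j, sobolevWeight s j := by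
  set F : ℤ → Ω → ℝ := fun j ω => if j = 0 then 0 else
    ((1 + (j : ℝ) ^ 2) ^ s) * (-(X j.natAbs ω) / (2 * (j.natAbs : ℝ))) ^ 2 with hF
  have hF' : ∀ j ω, F j ω = (if j = 0 then 0 else
      (1 + (j : ℝ) ^ 2) ^ s / (2 * (j.natAbs : ℝ)) ^ 2) * X j.natAbs ω ^ 2 := fun j ω => by
    simp only [hF]
    split_ifs
    · rw [zero_mul]
    · rw [div_pow, neg_sq]
      ring
  have hF0 : ∀ j ω, 0 ≤ F j ω := fun j ω => by
    simp only [hF]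
    split_ifs <;> positivity
  have hFi : ∀ j, Integrable (F j) μ := fun j => by
    simp only [funext (hF' j)]
    exact (hint _).const_mul _
  have hle : ∀ j, ∫ ω, F j ω ∂μ ≤ sobolevWeight s j := fun j => by
    simp only [hF', integral_const_mul]
    split_ifs with hj
    · rw [zero_mul]
      exact sobolevWeight_nonneg s j
    · have h := hX j.natAbs (Int.natAbs_pos.mpr hj)
      have h' : 0 ≤ ∫ ω, X j.natAbs ω ^ 2 ∂μ := integral_nonneg fun _ => sq_nonneg _
      have hj' : ((j.natAbs : ℕ) : ℝ) = |(j : ℝ)| := by rw [Nat.cast_natAbs, Int.cast_abs]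
      rw [hj'] at h ⊢
      have hjpos : 0 < |(j : ℝ)| := abs_pos.mpr (Int.cast_ne_zero.mpr hj)
      rw [sobolevWeight, ← sq_abs (j : ℝ), div_mul_eq_mul_div]
      gcongr
      linarith
  have hsum : Summable fun j => ∫ ω, F j ω ∂μ :=
    .of_nonneg_of_le (fun j => integral_nonneg (hF0 j)) hle (summable_sobolevWeight hs)
  have hswap : ∫ ω, hsNormSq s (fun k => X k ω) ∂μ = ∑' j, ∫ ω, F j ω ∂μ := by
    refine (integral_tsum_of_summable_integral_norm hFi ?_).symm
    simpa only [Real.norm_of_nonneg (hF0 _ _)] using hsum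
  rw [hswap]
  exact Summable.tsum_le_tsum hle hsum (summable_sobolevWeight hs)

end Moments

lemma isForm_sympJ (n : ℕ) : IsForm (-1) (sympJ n) where
  sign := Or.inr rfl
  transpose_eq := by
    rw [sympJ, fromBlocks_transpose, fromBlocks_smul]
    simp only [transpose_zero, transpose_one, transpose_neg, smul_zero, smul_neg, Int.cast_neg,
      Int.cast_one, neg_smul, one_smul, neg_neg]
  conjTranspose_eq := by
    simp [sympJ, fromBlocks_transpose, fromBlocks_conjTranspose]
  mul_transpose := by
    simp [sympJ, fromBlocks_transpose, fromBlocks_multiply]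

lemma isForm_one {ι : Type*} [Fintype ι] [DecidableEq ι] : IsForm 1 (1 : Matrix ι ι ℂ) where
  sign := Or.inl rfl
  transpose_eq := by simp
  conjTranspose_eq := by simp
  mul_transpose := by simp

lemma IsHaarSp.isFormHaar {n : ℕ} {μ : Measure (Matrix (Fin n ⊕ Fin n) (Fin n ⊕ Fin n) ℂ)}
    (hμ : IsHaarSp n μ) : IsFormHaar (sympJ n) μ :=
  ⟨hμ.1, hμ.2.1, hμ.2.2⟩

lemma continuous_map_ofReal {ι : Type*} :
    Continuous fun U : Matrix ι ι ℝ => U.map Complex.ofReal :=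
  continuous_id.matrix_map Complex.continuous_ofReal

lemma trace_map_ofReal_pow {ι : Type*} [Fintype ι] [DecidableEq ι] (U : Matrix ι ι ℝ) (k : ℕ) :
    (trace (U.map Complex.ofReal ^ k)).re = trace (U ^ k) := by
  have h : U.map Complex.ofReal ^ k = (U ^ k).map Complex.ofReal :=
    (map_pow (Complex.ofRealHom.mapMatrix (m := ι)) U k).symm
  rw [h, ← Complex.ofReal_re (trace (U ^ k))]
  congr 1
  simp [trace]

lemma mem_formGroup_one_iff {ι : Type*} [Fintype ι] [DecidableEq ι] {U : Matrix ι ι ℂ} :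
    U ∈ formGroup 1 ↔ ∃ W ∈ Matrix.orthogonalGroup ι ℝ, W.map Complex.ofReal = U := by
  have hmul : ∀ A B : Matrix ι ι ℝ, A.map Complex.ofReal * B.map Complex.ofReal
      = (A * B).map Complex.ofReal := fun A B =>
    (map_mul (Complex.ofRealHom.mapMatrix (m := ι)) A B).symm
  have hone : (1 : Matrix ι ι ℝ).map Complex.ofReal = 1 :=
    map_one (Complex.ofRealHom.mapMatrix (m := ι))
  constructor
  · intro hU
    have h1 : Uᴴ = Uᵀ := by
      simpa using isForm_one.conjTranspose_eq_conj hU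
    have h2 : (U.map Complex.re).map Complex.ofReal = U := by
      ext a b
      have := congrFun (congrFun h1 b) a
      rw [conjTranspose_apply, transpose_apply] at this
      exact Complex.conj_eq_iff_re.mp this
    refine ⟨U.map Complex.re, ?_, h2⟩
    rw [mem_orthogonalGroup_iff]
    have h3 : U * Uᵀ = 1 := by simpa using hU.2.1
    rw [← h2, ← transpose_map, hmul, ← hone] at h3
    exact Matrix.map_injective Complex.ofReal_injective h3
  · rintro ⟨W, hW, rfl⟩
    have h1 := (mem_orthogonalGroup_iff ι ℝ).mp hW
    have h2 := (mem_orthogonalGroup_iff' ι ℝ).mp hW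
    refine ⟨?_, ?_, ?_⟩
    · rw [mem_unitaryGroup_iff, star_eq_conjTranspose,
        show (W.map Complex.ofReal)ᴴ = Wᵀ.map Complex.ofReal by ext a b; simp, hmul, h1, hone]
    · rw [mul_one, ← transpose_map, hmul, h1, hone]
    · rw [mul_one, ← transpose_map, hmul, h2, hone]

lemma IsHaarON.isFormHaar {n : ℕ} {μ : Measure (Matrix (Fin n) (Fin n) ℝ)} (hμ : IsHaarON n μ) :
    IsFormHaar 1 (μ.map fun U => U.map Complex.ofReal) := by
  have := hμ.1
  have hm := (continuous_map_ofReal (ι := Fin n)).measurable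
  refine ⟨Measure.isProbabilityMeasure_map hm.aemeasurable, ?_, ?_⟩
  · refine (ae_map_iff (p := fun U => U ∈ formGroup 1) hm.aemeasurable
      (isCompact_formGroup 1).isClosed.measurableSet).mpr ?_
    have h : ∀ᵐ U ∂μ, U ∈ (Matrix.orthogonalGroup (Fin n) ℝ : Set (Matrix (Fin n) (Fin n) ℝ)) :=
      hμ.2.1
    filter_upwards [h] with U hU
    exact mem_formGroup_one_iff.mpr ⟨U, hU, rfl⟩
  · intro V hV
    obtain ⟨W, hW, rfl⟩ := mem_formGroup_one_iff.mp hV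
    have hl : Measurable fun U : Matrix (Fin n) (Fin n) ℂ => W.map Complex.ofReal * U :=
      Continuous.measurable (by fun_prop)
    have hl' : Measurable fun U : Matrix (Fin n) (Fin n) ℝ => W * U :=
      Continuous.measurable (by fun_prop)
    nth_rw 2 [← hμ.2.2 W hW]
    rw [Measure.map_map hl hm, Measure.map_map hm hl']
    congr 1
    funext U
    exact (map_mul (Complex.ofRealHom.mapMatrix (m := Fin n)) W U).symm

lemma IsHaarSp.integral_trace_sq_le {n : ℕ}
    {μ : Measure (Matrix (Fin n ⊕ Fin n) (Fin n ⊕ Fin n) ℂ)} (hμ : IsHaarSp n μ) {k : ℕ}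
    (hk : 1 ≤ k) : ∫ U, (trace (U ^ k)).re ^ 2 ∂μ ≤ 9 * k :=
  hμ.isFormHaar.integral_trace_sq_le (isForm_sympJ n) (M := 2 * n + 1)
    (by simp; ring) hk

lemma IsHaarON.integral_trace_sq_le {n : ℕ} {μ : Measure (Matrix (Fin n) (Fin n) ℝ)}
    (hμ : IsHaarON n μ) {k : ℕ} (hk : 1 ≤ k) : ∫ U, trace (U ^ k) ^ 2 ∂μ ≤ 9 * k := by
  rcases Nat.eq_zero_or_pos n with rfl | hn
  · simp [trace]
  · have h := hμ.isFormHaar.integral_trace_sq_le isForm_one (M := n - 1)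
      (by rw [Fintype.card_fin]; omega) hk
    rw [integral_map continuous_map_ofReal.aemeasurable
      (Continuous.aestronglyMeasurable (by fun_prop))] at h
    simpa only [trace_map_ofReal_pow] using h

lemma IsHaarSp.integrable_trace_sq {n : ℕ}
    {μ : Measure (Matrix (Fin n ⊕ Fin n) (Fin n ⊕ Fin n) ℂ)} (hμ : IsHaarSp n μ) (k : ℕ) :
    Integrable (fun U => (trace (U ^ k)).re ^ 2) μ :=
  hμ.isFormHaar.integrable (by fun_prop)

lemma IsHaarON.integrable_trace_sq {n : ℕ} {μ : Measure (Matrix (Fin n) (Fin n) ℝ)}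
    (hμ : IsHaarON n μ) (k : ℕ) : Integrable (fun U => trace (U ^ k) ^ 2) μ := by
  have h := hμ.isFormHaar.integrable (φ := fun U => (trace (U ^ k)).re ^ 2) (by fun_prop)
  have h' := h.comp_measurable continuous_map_ofReal.measurable
  simpa only [Function.comp_def, trace_map_ofReal_pow] using h'

end Assembly

/-- **Uniform Sobolev bound.**  For every `s < 0` there is `C_s > 0` such that for all
`n`, if `U_n` is Haar distributed on `O(n)` or on `Sp(2n)`, then
`∑_{k=1}^∞ (1+k²)^s E[(Tr U_n^k)²] / k² ≤ C_s`; in particular the supremum over `n` of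
the expected squared `H^s`-norm of the field with Fourier coefficients
`−Tr(U_n^{|j|})/(2|j|)` (`j ≠ 0`) is finite. -/
theorem sobolev_norm_trace_bound (s : ℝ) (hs : s < 0) :
    ∃ C : ℝ, 0 < C ∧
      (∀ (n : ℕ) (μ : Measure (Matrix (Fin n) (Fin n) ℝ)), IsHaarON n μ →
        (∑' k : ℕ, ((1 + ((k : ℝ) + 1) ^ 2) ^ s) *
            (∫ U, (Matrix.trace (U ^ (k + 1))) ^ 2 ∂μ) / ((k : ℝ) + 1) ^ 2) ≤ C ∧
        (∫ U, hsNormSq s (fun k => Matrix.trace (U ^ k)) ∂μ) ≤ C) ∧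
      (∀ (n : ℕ) (μ : Measure (Matrix (Fin n ⊕ Fin n) (Fin n ⊕ Fin n) ℂ)), IsHaarSp n μ →
        (∑' k : ℕ, ((1 + ((k : ℝ) + 1) ^ 2) ^ s) *
            (∫ U, ((Matrix.trace (U ^ (k + 1))).re) ^ 2 ∂μ) / ((k : ℝ) + 1) ^ 2) ≤ C ∧
        (∫ U, hsNormSq s (fun k => (Matrix.trace (U ^ k)).re) ∂μ) ≤ C) := by
  have h0 : 0 ≤ ∑' j, sobolevWeight s j := tsum_nonneg (sobolevWeight_nonneg s)
  have h1 : ∑' j, sobolevWeight s j ≤ 1 + ∑' j, sobolevWeight s j := by linarith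
  refine ⟨1 + ∑' j, sobolevWeight s j, by linarith, fun n μ hμ => ⟨?_, ?_⟩, fun n μ hμ => ⟨?_, ?_⟩⟩
  · exact (tsum_le_tsum_sobolevWeight hs (X := fun k U => trace (U ^ k))
      fun k hk => hμ.integral_trace_sq_le hk).trans h1
  · exact (integral_hsNormSq_le hs (X := fun k U => trace (U ^ k)) hμ.integrable_trace_sq
      fun k hk => hμ.integral_trace_sq_le hk).trans h1
  · exact (tsum_le_tsum_sobolevWeight hs
      (X := fun k (U : Matrix (Fin n ⊕ Fin n) (Fin n ⊕ Fin n) ℂ) => (trace (U ^ k)).re)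
      fun k hk => hμ.integral_trace_sq_le hk).trans h1
  · exact (integral_hsNormSq_le hs
      (X := fun k (U : Matrix (Fin n ⊕ Fin n) (Fin n ⊕ Fin n) ℂ) => (trace (U ^ k)).re)
      hμ.integrable_trace_sq
      fun k hk => hμ.integral_trace_sq_le hk).trans h1
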